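/- Let (X,ρ,μ) be a quasi-metric measure space in which μ is Borel regular and Q-doubling for some Q ∈ (0,∞). Fix s,p ∈ (0,∞) and q ∈ (0,∞] with s ⪯_q ind(X,ρ). If Ω ⊂ X is a nonempty μ-measurable set satisfying the measure density condition, then M^s_{p,q}(Ω,ρ,μ) coincides with the set of restrictions to Ω of functions in M^s_{p,q}(X,ρ,μ): a μ-measurable u: Ω→ℝ belongs to M^s_{p,q}(Ω,ρ,μ) if and only if there exists ũ ∈ M^s_{p,q}(X,ρ,μ) with ũ|_Ω = u μ-almost everywhere on Ω. -/

import Mathlib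

open MeasureTheory ENNReal Set

noncomputable section

namespace HajlaszPaper

variable {X : Type*}

/-- The `ρ`-ball centered at `x` with radius `r`. -/
def qball (ρ : X → X → ℝ) (x : X) (r : ℝ) : Set X := {y | ρ x y < r}

/-- `ρ` is a quasi-metric on `X`. -/
def IsQuasiDist (ρ : X → X → ℝ) : Prop :=
  (∀ x y, 0 ≤ ρ x y) ∧ (∀ x y, ρ x y = 0 ↔ x = y) ∧
    (∃ C₀ : ℝ, 1 ≤ C₀ ∧ ∀ x y, ρ y x ≤ C₀ * ρ x y) ∧
    (∃ C₁ : ℝ, 1 ≤ C₁ ∧ ∀ x y z, ρ x y ≤ C₁ * max (ρ x z) (ρ z y))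

/-- The least admissible quasi-triangle constant `C_ρ`. -/
def Crho (ρ : X → X → ℝ) : ℝ :=
  sInf {C : ℝ | 1 ≤ C ∧ ∀ x y z : X, ρ x y ≤ C * max (ρ x z) (ρ z y)}

/-- The least admissible quasi-symmetry constant `C̃_ρ`. -/
def CrhoTilde (ρ : X → X → ℝ) : ℝ :=
  sInf {C : ℝ | 1 ≤ C ∧ ∀ x y : X, ρ y x ≤ C * ρ x y}

/-- Two quasi-metrics are (bi-Lipschitz, i.e. pointwise) equivalent. -/
def EquivQM (ρ ϱ : X → X → ℝ) : Prop :=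
  ∃ c : ℝ, 1 ≤ c ∧ ∀ x y, c⁻¹ * ϱ x y ≤ ρ x y ∧ ρ x y ≤ c * ϱ x y

variable [MeasurableSpace X]

/-- `(X, ρ, μ)` is a quasi-metric measure space. -/
structure IsQMMS (ρ : X → X → ℝ) (μ : Measure X) : Prop where
  nontrivial : ∃ x y : X, x ≠ y
  quasi : IsQuasiDist ρ
  measurableSet_ball : ∀ (x : X) (r : ℝ), 0 < r → MeasurableSet (qball ρ x r)
  ball_pos : ∀ (x : X) (r : ℝ), 0 < r → 0 < μ (qball ρ x r)
  ball_lt_top : ∀ (x : X) (r : ℝ), 0 < r → μ (qball ρ x r) < ∞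

/-- Every `μ`-measurable set is contained in a Borel (measurable) set of equal measure. -/
def BorelRegular (μ : Measure X) : Prop :=
  ∀ A : Set X, ∃ B : Set X, A ⊆ B ∧ MeasurableSet B ∧ μ A = μ B

/-- `μ` is `Q`-doubling. -/
def QDoubling (ρ : X → X → ℝ) (μ : Measure X) (Q : ℝ) : Prop :=
  ∃ κ : ℝ, 0 < κ ∧ ∀ (x y : X) (r R : ℝ), 0 < r → r ≤ R →
    qball ρ x r ⊆ qball ρ y R →
    ENNReal.ofReal (κ * (r / R) ^ Q) * μ (qball ρ y R) ≤ μ (qball ρ x r)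

/-- `μ` is doubling. -/
def DoublingMeas (ρ : X → X → ℝ) (μ : Measure X) : Prop :=
  ∃ Cd : ℝ, 0 < Cd ∧ ∀ (x : X) (r : ℝ), 0 < r →
    μ (qball ρ x (2 * r)) ≤ ENNReal.ofReal Cd * μ (qball ρ x r)

/-- The measure density condition for `Ω`. -/
def MeasDensity (ρ : X → X → ℝ) (μ : Measure X) (Ω : Set X) : Prop :=
  ∃ c : ℝ, 0 < c ∧ ∀ x ∈ Ω, ∀ r : ℝ, 0 < r → r ≤ 1 →
    μ (qball ρ x r) ≤ ENNReal.ofReal c * μ (qball ρ x r ∩ Ω)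

/-- `Ω` is locally uniformly perfect with constant `lam ∈ (0,1)`. -/
def LocUnifPerfect (ρ : X → X → ℝ) (Ω : Set X) (lam : ℝ) : Prop :=
  ∀ x ∈ Ω, ∀ r : ℝ, 0 < r → r ≤ 1 → (Ω \ qball ρ x r).Nonempty →
    ((qball ρ x r ∩ Ω) \ qball ρ x (lam * r)).Nonempty

/-- The critical radius `φ^x_{Ω,ρ}(r)`. -/
def phiRad (ρ : X → X → ℝ) (μ : Measure X) (Ω : Set X) (x : X) (r : ℝ) : ℝ :=
  sSup {t : ℝ | 0 ≤ t ∧ t ≤ r ∧ μ (qball ρ x t ∩ Ω) ≤ μ (qball ρ x r ∩ Ω) / 2}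

/-- The collection `𝔻^s_ρ(u)` of fractional `s`-gradients of `u` on `Ω`. -/
def fracGrad (ρ : X → X → ℝ) (μ : Measure X) (Ω : Set X) (s : ℝ) (u : X → ℝ) :
    Set (ℤ → X → ℝ) :=
  {g | (∀ k x, 0 ≤ g k x) ∧ (∀ k, AEMeasurable (g k) (μ.restrict Ω)) ∧
    ∃ E : Set X, μ E = 0 ∧ ∀ k : ℤ, ∀ x ∈ Ω \ E, ∀ y ∈ Ω \ E,
      (2 : ℝ) ^ (-k - 1) ≤ ρ x y → ρ x y < (2 : ℝ) ^ (-k) →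
      |u x - u y| ≤ ρ x y ^ s * (g k x + g k y)}

/-- `g` is an `s`-gradient of `u` on `S`. -/
def IsSGradOn (ρ : X → X → ℝ) (μ : Measure X) (S : Set X) (s : ℝ) (u g : X → ℝ) : Prop :=
  (∀ x, 0 ≤ g x) ∧ AEMeasurable g (μ.restrict S) ∧
    ∃ E : Set X, μ E = 0 ∧ ∀ x ∈ S \ E, ∀ y ∈ S \ E,
      |u x - u y| ≤ ρ x y ^ s * (g x + g y)

/-- The `ℓ^q` norm (`0 < q ≤ ∞`) of a `ℤ`-indexed sequence in `[0,∞]`. -/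
def lqN (q : ℝ≥0∞) (a : ℤ → ℝ≥0∞) : ℝ≥0∞ :=
  if q = ∞ then ⨆ k, a k else (∑' k, a k ^ q.toReal) ^ (1 / q.toReal)

/-- The `L^p` "norm" (`0 < p < ∞`) of a `[0,∞]`-valued function. -/
def lpN (μ : Measure X) (p : ℝ) (f : X → ℝ≥0∞) : ℝ≥0∞ :=
  (∫⁻ x, f x ^ p ∂μ) ^ (1 / p)

/-- The `L^p` norm of `u : X → ℝ` over the set `Ω`. -/
def lpOn (μ : Measure X) (Ω : Set X) (p : ℝ) (u : X → ℝ) : ℝ≥0∞ :=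
  lpN (μ.restrict Ω) p fun x => ENNReal.ofReal |u x|

/-- The homogeneous Hajłasz–Triebel–Lizorkin quasi-norm `‖u‖_{Ṁ^s_{p,q}(Ω,ρ,μ)}`. -/
def MdotNorm (ρ : X → X → ℝ) (μ : Measure X) (Ω : Set X) (s p : ℝ) (q : ℝ≥0∞)
    (u : X → ℝ) : ℝ≥0∞ :=
  ⨅ g ∈ fracGrad ρ μ Ω s u,
    lpN (μ.restrict Ω) p fun x => lqN q fun k => ENNReal.ofReal (g k x)

/-- The homogeneous Hajłasz–Besov quasi-norm `‖u‖_{Ṅ^s_{p,q}(Ω,ρ,μ)}`. -/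
def NdotNorm (ρ : X → X → ℝ) (μ : Measure X) (Ω : Set X) (s p : ℝ) (q : ℝ≥0∞)
    (u : X → ℝ) : ℝ≥0∞ :=
  ⨅ g ∈ fracGrad ρ μ Ω s u,
    lqN q fun k => lpN (μ.restrict Ω) p fun x => ENNReal.ofReal (g k x)

/-- Membership in `M^s_{p,q}(Ω,ρ,μ)`. -/
def MemMspq (ρ : X → X → ℝ) (μ : Measure X) (Ω : Set X) (s p : ℝ) (q : ℝ≥0∞)
    (u : X → ℝ) : Prop :=
  AEMeasurable u (μ.restrict Ω) ∧ lpOn μ Ω p u ≠ ∞ ∧ MdotNorm ρ μ Ω s p q u ≠ ∞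

/-- Membership in `N^s_{p,q}(Ω,ρ,μ)`. -/
def MemNspq (ρ : X → X → ℝ) (μ : Measure X) (Ω : Set X) (s p : ℝ) (q : ℝ≥0∞)
    (u : X → ℝ) : Prop :=
  AEMeasurable u (μ.restrict Ω) ∧ lpOn μ Ω p u ≠ ∞ ∧ NdotNorm ρ μ Ω s p q u ≠ ∞

/-- The quasi-norm of `M^s_{p,q}(Ω,ρ,μ)`. -/
def MNorm (ρ : X → X → ℝ) (μ : Measure X) (Ω : Set X) (s p : ℝ) (q : ℝ≥0∞)
    (u : X → ℝ) : ℝ≥0∞ :=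
  MdotNorm ρ μ Ω s p q u + lpOn μ Ω p u

/-- The quasi-norm of `N^s_{p,q}(Ω,ρ,μ)`. -/
def NNorm (ρ : X → X → ℝ) (μ : Measure X) (Ω : Set X) (s p : ℝ) (q : ℝ≥0∞)
    (u : X → ℝ) : ℝ≥0∞ :=
  NdotNorm ρ μ Ω s p q u + lpOn μ Ω p u

/-- `s ⪯_q ind(X,ρ)` : there is a quasi-metric `ϱ ≈ ρ` with `s ≤ (log₂ C_ϱ)⁻¹`
(equivalently `C_ϱ ^ s ≤ 2`), where equality is permitted only when `q = ∞`. -/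
def SPrecIndex (ρ : X → X → ℝ) (s : ℝ) (q : ℝ≥0∞) : Prop :=
  ∃ ϱ : X → X → ℝ, IsQuasiDist ϱ ∧ EquivQM ρ ϱ ∧
    (Crho ϱ ^ s < 2 ∨ (q = ∞ ∧ Crho ϱ ^ s ≤ 2))

/-- `s < ind(X,ρ)` : there is a quasi-metric `ϱ ≈ ρ` with `s < (log₂ C_ϱ)⁻¹`
(equivalently `C_ϱ ^ s < 2`). -/
def SLtIndex (ρ : X → X → ℝ) (s : ℝ) : Prop :=
  ∃ ϱ : X → X → ℝ, IsQuasiDist ϱ ∧ EquivQM ρ ϱ ∧ Crho ϱ ^ s < 2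

/-- The median value `m_u(E)`. -/
def medianVal (μ : Measure X) (E : Set X) (u : X → ℝ) : ℝ :=
  sSup {θ : ℝ | μ {x ∈ E | u x < θ} ≤ μ E / 2}

/-- `f` belongs to the homogeneous Hölder space `Ċ^α(X,ρ)`. -/
def MemHolder (ρ : X → X → ℝ) (α : ℝ) (f : X → ℝ) : Prop :=
  ∃ H : ℝ, 0 ≤ H ∧ ∀ x y : X, |f x - f y| ≤ H * ρ x y ^ α

/-- The Hölder seminorm `‖f‖_{Ċ^α(X,ρ)}`. -/
def holderNorm (ρ : X → X → ℝ) (α : ℝ) (f : X → ℝ) : ℝ :=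
  sInf {H : ℝ | 0 ≤ H ∧ ∀ x y : X, |f x - f y| ≤ H * ρ x y ^ α}

/-- The sup norm of `f`. -/
def supNorm (f : X → ℝ) : ℝ := sSup (Set.range fun x => |f x|)

/-- `ρ` is a genuine metric. -/
def IsMetricDist (ρ : X → X → ℝ) : Prop :=
  (∀ x y, 0 ≤ ρ x y) ∧ (∀ x y, ρ x y = 0 ↔ x = y) ∧ (∀ x y, ρ x y = ρ y x) ∧
    (∀ x y z, ρ x y ≤ ρ x z + ρ z y)

/-- The homogeneous Hajłasz–Sobolev quasi-norm `‖u‖_{Ṁ^{1,p}(Ω,ρ,μ)}`. -/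
def M1pDotNorm (ρ : X → X → ℝ) (μ : Measure X) (Ω : Set X) (p : ℝ) (u : X → ℝ) : ℝ≥0∞ :=
  ⨅ g ∈ {g : X → ℝ | IsSGradOn ρ μ Ω 1 u g},
    lpN (μ.restrict Ω) p fun x => ENNReal.ofReal (g x)

/-- Membership in the Hajłasz–Sobolev space `M^{1,p}(Ω,ρ,μ)`. -/
def MemM1p (ρ : X → X → ℝ) (μ : Measure X) (Ω : Set X) (p : ℝ) (u : X → ℝ) : Prop :=
  AEMeasurable u (μ.restrict Ω) ∧ lpOn μ Ω p u ≠ ∞ ∧ M1pDotNorm ρ μ Ω p u ≠ ∞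

/-- The quasi-norm of `M^{1,p}(Ω,ρ,μ)`. -/
def M1pNorm (ρ : X → X → ℝ) (μ : Measure X) (Ω : Set X) (p : ℝ) (u : X → ℝ) : ℝ≥0∞ :=
  lpOn μ Ω p u + M1pDotNorm ρ μ Ω p u

section

open Metric Filter Topology

section Metrization

variable {X : Type*}

/-- The chain estimate behind the metrization of quasi-metrics with constant `2`. -/
lemma chain_bound {δ : X → X → ℝ} (h0 : ∀ x y, 0 ≤ δ x y)
    (h2 : ∀ x y z, δ x y ≤ 2 * max (δ x z) (δ z y)) (n : ℕ) (f : ℕ → X) :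
    δ (f 0) (f (n + 2)) + 2 * δ (f 0) (f 1) + 2 * δ (f (n + 1)) (f (n + 2)) ≤
      4 * ∑ i ∈ Finset.range (n + 2), δ (f i) (f (i + 1)) := by
  induction n using Nat.strong_induction_on generalizing f with
  | _ n ih =>
    have hends : δ (f 0) (f 1) + δ (f (n + 1)) (f (n + 2)) ≤
        ∑ i ∈ Finset.range (n + 2), δ (f i) (f (i + 1)) := by
      rw [Finset.sum_range_succ, Finset.sum_range_succ']
      have := Finset.sum_nonneg (s := Finset.range n)
        (f := fun i => δ (f (i + 1)) (f (i + 1 + 1))) fun i _ => h0 _ _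
      simp only [zero_add]
      linarith
    by_cases hlast : δ (f 0) (f (n + 2)) ≤ 2 * δ (f (n + 1)) (f (n + 2))
    · have := h0 (f 0) (f 1)
      linarith
    obtain ⟨p, hpn, hp, hp1⟩ : ∃ p ≤ n, δ (f 0) (f (n + 2)) ≤ 2 * δ (f p) (f (n + 2)) ∧
        ¬ δ (f 0) (f (n + 2)) ≤ 2 * δ (f (p + 1)) (f (n + 2)) := by
      by_contra! hcon
      have : ∀ p ≤ n + 1, δ (f 0) (f (n + 2)) ≤ 2 * δ (f p) (f (n + 2)) := by
        intro p
        induction p with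
        | zero => intro _; have := h0 (f 0) (f (n + 2)); linarith
        | succ p ihp => intro hp; exact hcon p (by omega) (ihp (by omega))
      exact hlast (this (n + 1) le_rfl)
    have hfirst : δ (f 0) (f (n + 2)) ≤ 2 * δ (f 0) (f (p + 1)) := by
      have := h2 (f 0) (f (n + 2)) (f (p + 1))
      rcases max_choice (δ (f 0) (f (p + 1))) (δ (f (p + 1)) (f (n + 2))) with h | h <;>
        rw [h] at this
      · exact this
      · exact absurd this hp1
    rcases Nat.eq_zero_or_pos p with rfl | hppos
    · have := h0 (f (n + 1)) (f (n + 2))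
      simp only [zero_add] at hfirst
      linarith
    obtain ⟨k, rfl⟩ : ∃ k, p = k + 1 := ⟨p - 1, by omega⟩
    obtain ⟨l, rfl⟩ : ∃ l, n = k + 1 + l := ⟨n - (k + 1), by omega⟩
    have i1 := ih k (by omega) f
    have i2 := ih l (by omega) fun i => f (k + 1 + i)
    have e1 : ∑ i ∈ Finset.range (k + 1 + l + 2), δ (f i) (f (i + 1)) =
        ∑ i ∈ Finset.range (k + 1), δ (f i) (f (i + 1)) +
          ∑ i ∈ Finset.range (l + 2), δ (f (k + 1 + i)) (f (k + 1 + (i + 1))) := by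
      rw [show k + 1 + l + 2 = k + 1 + (l + 2) by ring, Finset.sum_range_add]
      rfl
    have e2 : ∑ i ∈ Finset.range (k + 2), δ (f i) (f (i + 1)) =
        ∑ i ∈ Finset.range (k + 1), δ (f i) (f (i + 1)) + δ (f (k + 1)) (f (k + 2)) :=
      Finset.sum_range_succ _ _
    simp only [add_zero] at i2
    rw [e1]
    rw [e2] at i1
    simp only [show k + 1 + 1 = k + 2 by ring, show k + 1 + (l + 2) = k + 1 + l + 2 by ring,
      show k + 1 + (l + 1) = k + 1 + l + 1 by ring] at *
    linarith

lemma exists_path (d : X → X → NNReal) (l : List X) (x y : X) :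
    ∃ (n : ℕ) (f : ℕ → X), f 0 = x ∧ f (n + 1) = y ∧
      ((x :: l).zipWith d (l ++ [y])).sum = ∑ i ∈ Finset.range (n + 1), d (f i) (f (i + 1)) := by
  induction l generalizing x with
  | nil => exact ⟨0, fun i => if i = 0 then x else y, by simp, by simp, by simp⟩
  | cons a l ih =>
    obtain ⟨n, f, h0, h1, h2⟩ := ih a
    refine ⟨n + 1, fun i => Nat.casesOn i x f, rfl, h1, ?_⟩
    rw [Finset.sum_range_succ', List.cons_append, List.zipWith_cons_cons, List.sum_cons, h2, add_comm]
    simp [h0]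

lemma le_four_mul_dist_ofPreNNDist (d : X → X → NNReal) (dist_self : ∀ x, d x x = 0)
    (dist_comm : ∀ x y, d x y = d y x) (hd : ∀ x y z, d x y ≤ 2 * max (d x z) (d z y)) (x y : X) :
    (d x y : ℝ) ≤ 4 * @dist X (@PseudoMetricSpace.toDist X
      (PseudoMetricSpace.ofPreNNDist d dist_self dist_comm)) x y := by
  rw [PseudoMetricSpace.dist_ofPreNNDist, ← NNReal.coe_ofNat, ← NNReal.coe_mul, NNReal.mul_iInf,
    NNReal.coe_le_coe]
  refine le_ciInf fun l => ?_
  obtain ⟨n, f, h0, h1, h2⟩ := exists_path d l x y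
  rw [h2, ← h0, ← h1, ← NNReal.coe_le_coe]
  push_cast
  rcases n with _ | n
  · simp only [zero_add, Finset.range_one, Finset.sum_singleton]
    have := (d (f 0) (f 1)).2
    linarith
  · have := chain_bound (δ := fun x y => (d x y : ℝ)) (fun x y => (d x y).2)
      (fun x y z => by exact_mod_cast hd x y z) n f
    have h3 := (d (f 0) (f 1)).2
    have h4 := (d (f (n + 1)) (f (n + 2))).2
    linarith

lemma Crho_mem {ϱ : X → X → ℝ} (h : IsQuasiDist ϱ) :
    1 ≤ Crho ϱ ∧ ∀ x y z : X, ϱ x y ≤ Crho ϱ * max (ϱ x z) (ϱ z y) := by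
  have hcl : IsClosed {C : ℝ | 1 ≤ C ∧ ∀ x y z : X, ϱ x y ≤ C * max (ϱ x z) (ϱ z y)} := by
    simp only [ofPred_and, ofPred_forall]
    refine (isClosed_le continuous_const continuous_id).inter ?_
    exact isClosed_iInter fun x => isClosed_iInter fun y => isClosed_iInter fun z =>
      isClosed_le continuous_const (by fun_prop)
  obtain ⟨-, -, -, C, hC⟩ := h
  exact hcl.csInf_mem ⟨C, hC⟩ ⟨1, fun _ h => h.1⟩

lemma exists_exponent {ρ : X → X → ℝ} {s : ℝ} {q : ℝ≥0∞} (h : SPrecIndex ρ s q) :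
    ∃ ϱ : X → X → ℝ, IsQuasiDist ϱ ∧ EquivQM ρ ϱ ∧ ∃ β : ℝ, s ≤ β ∧ (q ≠ ∞ → s < β) ∧
      Crho ϱ ^ β ≤ 2 := by
  obtain ⟨ϱ, hϱ, heq, h | ⟨rfl, h⟩⟩ := h
  · refine ⟨ϱ, hϱ, heq, ?_⟩
    have hC := (Crho_mem hϱ).1
    have hcont : ContinuousAt (fun β : ℝ => Crho ϱ ^ β) s :=
      Real.continuousAt_const_rpow (by linarith)
    have h1 := (hcont.eventually (gt_mem_nhds h)).filter_mono
      (nhdsWithin_le_nhds (s := Ioi s))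
    obtain ⟨β, hβ, hsβ⟩ := (h1.and self_mem_nhdsWithin).exists
    exact ⟨β, le_of_lt hsβ, fun _ => hsβ, hβ.le⟩
  · exact ⟨ϱ, hϱ, heq, s, le_rfl, fun h => absurd rfl h, h⟩

/-- A quasi-metric of index above `s` has a power (at least the `s`-th) equivalent to a metric. -/
lemma exists_metric {ρ : X → X → ℝ} {s : ℝ} {q : ℝ≥0∞} (hρ : IsQuasiDist ρ) (hs : 0 < s)
    (h : SPrecIndex ρ s q) :
    ∃ (β : ℝ) (m : PseudoMetricSpace X) (c : ℝ), s ≤ β ∧ (q ≠ ∞ → s < β) ∧ 1 ≤ c ∧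
      ∀ x y, m.dist x y ≤ c * ρ x y ^ β ∧ ρ x y ^ β ≤ c * m.dist x y := by
  obtain ⟨ϱ, hϱ, ⟨e, he1, he⟩, β, hsβ, hsβ', hC2⟩ := exists_exponent h
  obtain ⟨hC1, hC⟩ := Crho_mem hϱ
  obtain ⟨hn, hz, ⟨C₀, hC01, hC0⟩, -⟩ := hϱ
  have hβ : 0 < β := hs.trans_le hsβ
  have he0 : 0 < e := by linarith
  have hC00 : 0 < C₀ := by linarith
  set σ : X → X → ℝ := fun x y => max (ϱ x y) (ϱ y x)
  have hσn : ∀ x y, 0 ≤ σ x y := fun x y => (hn x y).trans (le_max_left _ _)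
  have hσ : ∀ x y z, σ x y ≤ Crho ϱ * max (σ x z) (σ z y) := by
    intro x y z
    refine max_le ((hC x y z).trans ?_) ((hC y x z).trans ?_)
    · gcongr <;> exact le_max_left _ _
    · rw [max_comm]
      gcongr <;> exact le_max_right _ _
  set d : X → X → NNReal := fun x y => ⟨σ x y ^ β, Real.rpow_nonneg (hσn x y) β⟩
  have hself : ∀ x, d x x = 0 := fun x => by
    apply NNReal.eq
    change max (ϱ x x) (ϱ x x) ^ β = 0
    rw [(hz x x).2 rfl, max_self, Real.zero_rpow hβ.ne']
  have hcomm : ∀ x y, d x y = d y x := fun x y => by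
    apply NNReal.eq
    simp [d, σ, max_comm]
  have htri : ∀ x y z, d x y ≤ 2 * max (d x z) (d z y) := by
    intro x y z
    rw [← NNReal.coe_le_coe]
    push_cast
    change σ x y ^ β ≤ 2 * max (σ x z ^ β) (σ z y ^ β)
    calc σ x y ^ β ≤ (Crho ϱ * max (σ x z) (σ z y)) ^ β :=
          Real.rpow_le_rpow (hσn _ _) (hσ x y z) hβ.le
      _ = Crho ϱ ^ β * max (σ x z) (σ z y) ^ β :=
          Real.mul_rpow (by linarith) (le_max_of_le_left (hσn _ _))
      _ ≤ 2 * max (σ x z) (σ z y) ^ β := by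
          gcongr
          exact Real.rpow_nonneg (le_max_of_le_left (hσn _ _)) β
      _ = _ := by
          rw [(Real.monotoneOn_rpow_Ici_of_exponent_nonneg hβ.le).map_max (hσn _ _) (hσn _ _)]
  have h4 := le_four_mul_dist_ofPreNNDist d hself hcomm htri
  have h5 := PseudoMetricSpace.dist_ofPreNNDist_le d hself hcomm
  refine ⟨β, PseudoMetricSpace.ofPreNNDist d hself hcomm, (4 * (e * C₀) ^ β), hsβ, hsβ', ?_, ?_⟩
  · have : (1 : ℝ) ≤ (e * C₀) ^ β := Real.one_le_rpow (by nlinarith) hβ.le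
    linarith
  intro x y
  have hρ0 := hρ.1 x y
  have hpow : (1 : ℝ) ≤ (e * C₀) ^ β := Real.one_le_rpow (by nlinarith) hβ.le
  have hσρ : σ x y ≤ e * C₀ * ρ x y := by
    have h1 : ϱ x y ≤ e * ρ x y := by
      have := (he x y).1
      rwa [inv_mul_le_iff₀ he0] at this
    have h2 := hC0 x y
    have h3 := hn x y
    refine max_le ?_ ?_
    · nlinarith
    · nlinarith
  have hρσ : ρ x y ≤ e * σ x y :=
    (he x y).2.trans (by gcongr; exact le_max_left _ _)
  constructor
  · refine (h5 x y).trans ?_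
    change σ x y ^ β ≤ _
    refine (Real.rpow_le_rpow (hσn _ _) hσρ hβ.le).trans ?_
    rw [Real.mul_rpow (by positivity) hρ0]
    have := Real.rpow_nonneg hρ0 β
    nlinarith [mul_nonneg (by linarith : (0:ℝ) ≤ (e * C₀) ^ β) this]
  · have h6 : σ x y ^ β ≤ 4 * _ := h4 x y
    have h7 : ρ x y ^ β ≤ e ^ β * σ x y ^ β := by
      rw [← Real.mul_rpow he0.le (hσn _ _)]
      exact Real.rpow_le_rpow hρ0 hρσ hβ.le
    have h8 : e ^ β ≤ (e * C₀) ^ β := Real.rpow_le_rpow he0.le (by nlinarith) hβ.le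
    have h9 : (0:ℝ) ≤ σ x y ^ β := Real.rpow_nonneg (hσn _ _) β
    calc ρ x y ^ β ≤ e ^ β * σ x y ^ β := h7
      _ ≤ (e * C₀) ^ β * (4 * _) := mul_le_mul h8 h6 h9 (by linarith)
      _ = _ := by ring

end Metrization

/-- A measure that is doubling for metric balls, together with a measurable set that has positive
density at its points, uniformly at scales at most one. -/
structure DoublingDomain {X : Type*} [PseudoMetricSpace X] [MeasurableSpace X]
    (μ : Measure X) (Ω : Set X) : Prop where
  ball_pos : ∀ (x : X) (r : ℝ), 0 < r → 0 < μ (ball x r)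
  ball_lt_top : ∀ (x : X) (r : ℝ), μ (ball x r) < ∞
  doubling : ∀ K : ℝ, ∃ C : NNReal, ∀ (x : X) (r : ℝ), 0 < r → μ (ball x (K * r)) ≤ C * μ (ball x r)
  measurableSet : MeasurableSet Ω
  density : ∃ C : NNReal, ∀ x ∈ Ω, ∀ r : ℝ, 0 < r → r ≤ 1 → μ (ball x r) ≤ C * μ (ball x r ∩ Ω)

section

variable {X : Type*} [PseudoMetricSpace X] [MeasurableSpace X] [OpensMeasurableSpace X]
  [SecondCountableTopology X] {μ : Measure X} {Ω : Set X}

/-- A weak-type covering estimate: sets of points seen from balls whose trace on `Ω` lies in `G`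
are controlled in measure by `G`. -/
lemma DoublingDomain.weak_type (h : DoublingDomain μ Ω) (K : ℝ) :
    ∃ C : NNReal, ∀ A G : Set X, MeasurableSet G →
      (∀ x ∈ A, ∃ y ∈ Ω, ∃ r : ℝ, 0 < r ∧ r ≤ 1 ∧ dist x y ≤ K * r ∧ ball y r ∩ Ω ⊆ G) →
      μ A ≤ C * μ (Ω ∩ G) := by
  obtain ⟨C₁, hC₁⟩ := h.doubling (2 * |K| + 4)
  obtain ⟨C₂, hC₂⟩ := h.density
  refine ⟨C₁ * C₂, fun A G hG hA => ?_⟩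
  choose! y hy r hr0 hr1 hd hG' using hA
  obtain ⟨u, huA, hdisj, hcov⟩ := Vitali.exists_disjoint_subfamily_covering_enlargement
    (fun x => ball (y x) (r x)) A r 2 one_lt_two (fun a ha => (hr0 a ha).le) 1 hr1
    (fun a ha => ⟨y a, mem_ball_self (hr0 a ha)⟩)
  have hcount : u.Countable := hdisj.countable_of_isOpen (fun _ _ => isOpen_ball)
    (fun a ha => ⟨y a, mem_ball_self (hr0 a (huA ha))⟩)
  have hsub : A ⊆ ⋃ b ∈ u, ball (y b) ((2 * |K| + 4) * r b) := by
    intro a ha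
    obtain ⟨b, hb, ⟨z, hza, hzb⟩, hab⟩ := hcov a ha
    simp only [mem_iUnion]
    refine ⟨b, hb, ?_⟩
    rw [mem_ball] at *
    have h1 := dist_triangle a (y a) (y b)
    have h2 := dist_triangle_left (y a) (y b) z
    have h3 : dist a (y a) ≤ |K| * r a := (hd a ha).trans
      (mul_le_mul_of_nonneg_right (le_abs_self K) (hr0 a ha).le)
    have h4 : |K| * r a ≤ |K| * (2 * r b) := mul_le_mul_of_nonneg_left hab (abs_nonneg K)
    nlinarith [hr0 b (huA hb)]
  calc μ A ≤ μ (⋃ b ∈ u, ball (y b) ((2 * |K| + 4) * r b)) := measure_mono hsub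
    _ ≤ ∑' b : u, μ (ball (y b) ((2 * |K| + 4) * r b)) := measure_biUnion_le _ hcount _
    _ ≤ ∑' b : u, ↑(C₁ * C₂) * μ (ball (y b) (r b) ∩ Ω) := by
        refine ENNReal.tsum_le_tsum fun b => ?_
        have hb := huA b.2
        refine (hC₁ _ _ (hr0 b hb)).trans ?_
        rw [ENNReal.coe_mul, mul_assoc]
        gcongr
        exact hC₂ _ (hy b hb) _ (hr0 b hb) (hr1 b hb)
    _ = ↑(C₁ * C₂) * μ (⋃ b ∈ u, ball (y b) (r b) ∩ Ω) := by
        rw [ENNReal.tsum_mul_left, measure_biUnion hcount]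
        · exact hdisj.mono fun _ => inter_subset_left
        · exact fun b _ => measurableSet_ball.inter h.measurableSet
    _ ≤ ↑(C₁ * C₂) * μ (Ω ∩ G) := by
        gcongr
        refine iUnion₂_subset fun b hb => subset_inter inter_subset_right ?_
        exact hG' b (huA hb)

end

section

variable {X : Type*} [MeasurableSpace X] {μ : Measure X}

/-- The layer cake formula for functions with values in `[0, ∞]`. -/
lemma lintegral_eq_lintegral_measure_ofReal_lt [SFinite μ] {f : X → ℝ≥0∞} (hf : Measurable f) :
    ∫⁻ x, f x ∂μ = ∫⁻ t in Ioi (0 : ℝ), μ {x | ENNReal.ofReal t < f x} := by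
  have hS : MeasurableSet {z : X × ℝ | ENNReal.ofReal z.2 < f z.1} :=
    measurableSet_lt (ENNReal.measurable_ofReal.comp measurable_snd) (hf.comp measurable_fst)
  have key : ∀ a : ℝ≥0∞, (volume.restrict (Ioi (0 : ℝ))) {t | ENNReal.ofReal t < a} = a := by
    intro a
    have hm : MeasurableSet {t : ℝ | ENNReal.ofReal t < a} :=
      measurableSet_lt ENNReal.measurable_ofReal measurable_const
    rw [Measure.restrict_apply hm]
    induction a with
    | top => simp
    | coe a =>
      have : {t : ℝ | ENNReal.ofReal t < a} ∩ Ioi 0 = Ioo 0 (a : ℝ) := by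
        ext t
        simp only [mem_inter_iff, mem_ofPred_eq, mem_Ioi, mem_Ioo]
        constructor
        · rintro ⟨h1, h2⟩
          refine ⟨h2, ?_⟩
          rw [← ENNReal.ofReal_coe_nnreal] at h1
          exact (ENNReal.ofReal_lt_ofReal_iff_of_nonneg h2.le).1 h1
        · rintro ⟨h1, h2⟩
          refine ⟨?_, h1⟩
          rw [← ENNReal.ofReal_coe_nnreal]
          exact (ENNReal.ofReal_lt_ofReal_iff_of_nonneg h1.le).2 h2
      rw [this]
      simp
  have h1 := Measure.prod_apply (μ := μ) (ν := volume.restrict (Ioi (0 : ℝ))) hS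
  have h2 := Measure.prod_apply_symm (μ := μ) (ν := volume.restrict (Ioi (0 : ℝ))) hS
  rw [h1] at h2
  exact (lintegral_congr fun x => (key (f x)).symm).trans h2

lemma lintegral_le_of_measure_lt_le {ν : Measure X} [SFinite μ] [SFinite ν] {f g : X → ℝ≥0∞}
    (hf : Measurable f) (hg : Measurable g) {C : NNReal}
    (h : ∀ t : ℝ≥0∞, μ {x | t < f x} ≤ C * ν {x | t < g x}) :
    ∫⁻ x, f x ∂μ ≤ C * ∫⁻ x, g x ∂ν := by
  rw [lintegral_eq_lintegral_measure_ofReal_lt hf, lintegral_eq_lintegral_measure_ofReal_lt hg,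
    ← lintegral_const_mul' _ _ ENNReal.coe_ne_top]
  exact lintegral_mono fun t => h _

end

section

variable {X : Type*} [PseudoMetricSpace X] [MeasurableSpace X] [OpensMeasurableSpace X]
  [SecondCountableTopology X] {μ : Measure X} [SigmaFinite μ] {Ω : Set X}

/-- The strong-type consequence of the covering estimate. -/
lemma DoublingDomain.lintegral_le (h : DoublingDomain μ Ω) (K : ℝ) :
    ∃ C : NNReal, ∀ (A : Set X) (f g : X → ℝ≥0∞), MeasurableSet A → Measurable f → Measurable g →
      (∀ x ∈ A, ∀ t < f x, ∃ y ∈ Ω, ∃ r : ℝ, 0 < r ∧ r ≤ 1 ∧ dist x y ≤ K * r ∧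
        ∀ z ∈ ball y r ∩ Ω, t < g z) →
      ∫⁻ x in A, f x ∂μ ≤ C * ∫⁻ x in Ω, g x ∂μ := by
  obtain ⟨C, hC⟩ := h.weak_type K
  refine ⟨C, fun A f g hA hf hg hfg => lintegral_le_of_measure_lt_le hf hg fun t => ?_⟩
  have hgt : MeasurableSet {x | t < g x} := measurableSet_lt measurable_const hg
  rw [Measure.restrict_apply (measurableSet_lt measurable_const hf), Measure.restrict_apply hgt,
    inter_comm _ Ω]
  exact hC _ _ hgt fun x hx => hfg x hx.2 t hx.1

end

/-- The properties of a functional on moduli `w : ℝ → [0, ∞]` that are needed to control how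
moduli behave under extension. -/
structure IsCost (N : (ℝ → ℝ≥0∞) → ℝ≥0∞) (K : NNReal) : Prop where
  add_le : ∀ w w' : ℝ → ℝ≥0∞, N (fun t => w t + w' t) ≤ K * (N w + N w')
  const_mul_le : ∀ (c : NNReal) (w : ℝ → ℝ≥0∞), N (fun t => c * w t) ≤ c * N w
  linear_le : ∀ a : NNReal, N (fun t => ENNReal.ofReal t * a) ≤ K * a
  liminf_le : ∀ w : ℕ → ℝ → ℝ≥0∞,
    N (fun t => liminf (fun m => w m t) atTop) ≤ liminf (fun m => N (w m)) atTop
  measurable : Measurable N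
  small : ∀ ε : NNReal, 0 < ε → ∃ t : ℝ, 0 < t ∧ ∀ w, w t ≤ ε * N w

/-- `w` is a modulus of continuity of `u` on `S`, additively distributed between two points. -/
structure HasModulus {X : Type*} [PseudoMetricSpace X] [MeasurableSpace X]
    (S : Set X) (u : X → ℝ) (w : X → ℝ → ℝ≥0∞) : Prop where
  measurable_fun : Measurable u
  measurable_modulus : ∀ t, Measurable fun x => w x t
  edist_le : ∀ x ∈ S, ∀ y ∈ S, ∀ t, 0 < t → dist x y < t → edist (u x) (u y) ≤ w x t + w y t

/-- The energy density attached to a function and its modulus. -/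
def energy {X : Type*} (N : (ℝ → ℝ≥0∞) → ℝ≥0∞) (p : ℝ) (u : X → ℝ) (w : X → ℝ → ℝ≥0∞) (x : X) :
    ℝ≥0∞ :=
  N (w x) ^ p + ‖u x‖ₑ ^ p

lemma measurable_energy {X : Type*} [MeasurableSpace X] {N : (ℝ → ℝ≥0∞) → ℝ≥0∞}
    (hN : Measurable N) {p : ℝ} {u : X → ℝ} {w : X → ℝ → ℝ≥0∞} (hu : Measurable u)
    (hw : ∀ t, Measurable fun x => w x t) : Measurable (energy N p u w) :=
  ((hN.comp (measurable_pi_lambda _ hw)).pow_const p).add (hu.enorm.pow_const p)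

lemma edist_le_liminf_add {a : ℕ → ℝ} {a' b : ℝ} {w : ℕ → ℝ≥0∞} {c : ℝ≥0∞}
    (ha : Tendsto a atTop (𝓝 a')) (h : ∀ᶠ m in atTop, edist (a m) b ≤ w m + c) :
    edist a' b ≤ liminf w atTop + c := by
  rw [← tsub_le_iff_right]
  have h1 : Tendsto (fun m => edist (a m) b - c) atTop (𝓝 (edist a' b - c)) :=
    ((ENNReal.continuous_sub_right c).tendsto _).comp (ha.edist tendsto_const_nhds)
  rw [← h1.liminf_eq]
  exact liminf_le_liminf (h.mono fun m hm => tsub_le_iff_right.2 hm)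

section

variable {X : Type*} [PseudoMetricSpace X] [MeasurableSpace X] [OpensMeasurableSpace X]

lemma exists_measurable_approx [SecondCountableTopology X] [Nonempty X] {Ω Z : Set X}
    {F Φ : X → ℝ≥0∞} (hΦ : Measurable Φ) (hZ : MeasurableSet Z)
    (hne : ∀ x ∈ Z, ∀ r > 0, ∃ z ∈ Ω, dist z x < r ∧ F z < Φ x) :
    ∃ (e : ℕ → X) (idx : ℕ → X → ℕ), (∀ m, Measurable (idx m)) ∧ ∀ m : ℕ, ∀ x ∈ Z,
      e (idx m x) ∈ Ω ∧ dist (e (idx m x)) x < 1 / ((m : ℝ) + 1) ∧ F (e (idx m x)) < Φ x := by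
  classical
  have hD : ∀ q : ℚ, ∃ t ⊆ {z ∈ Ω | F z < Real.toNNReal q}, t.Countable ∧
      {z ∈ Ω | F z < Real.toNNReal q} ⊆ closure t := fun q =>
    (TopologicalSpace.IsSeparable.of_separableSpace _).exists_countable_dense_subset
  choose D hDsub hDc hDd using hD
  obtain ⟨x₀⟩ := ‹Nonempty X›
  obtain ⟨e, he⟩ := (((countable_iUnion hDc).union (countable_singleton x₀))).exists_eq_range
    ⟨x₀, Or.inr rfl⟩
  set P : ℕ → X → ℕ → Prop := fun m x n =>
    x ∉ Z ∨ (e n ∈ Ω ∧ dist (e n) x < 1 / ((m : ℝ) + 1) ∧ F (e n) < Φ x) with hP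
  have hex : ∀ m x, ∃ n, P m x n := by
    intro m x
    by_cases hx : x ∈ Z
    · obtain ⟨z, hz, hzd, hzF⟩ := hne x hx (1 / ((m : ℝ) + 1)) (by positivity)
      obtain ⟨q, -, hq1, hq2⟩ := ENNReal.lt_iff_exists_rat_btwn.1 hzF
      obtain ⟨z', hz', hdist⟩ := Metric.mem_closure_iff.1 (hDd q ⟨hz, hq1⟩)
        (1 / ((m : ℝ) + 1) - dist z x) (by linarith)
      have : z' ∈ range e := he ▸ Or.inl (mem_iUnion.2 ⟨q, hz'⟩)
      obtain ⟨n, rfl⟩ := this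
      refine ⟨n, Or.inr ⟨(hDsub q hz').1, ?_, (hDsub q hz').2.trans hq2⟩⟩
      have := dist_triangle_left (e n) x z
      linarith
    · exact ⟨0, Or.inl hx⟩
  refine ⟨e, fun m x => Nat.find (hex m x), fun m => ?_, fun m x hx => ?_⟩
  · refine measurable_find (hex m) fun k => ?_
    refine hZ.compl.union ((MeasurableSet.const _).inter ((?_ : MeasurableSet _).inter ?_))
    · have : {x | dist (e k) x < 1 / ((m : ℝ) + 1)} = ball (e k) (1 / ((m : ℝ) + 1)) := by
        ext x; simp [dist_comm]
      change MeasurableSet {x | dist (e k) x < 1 / ((m : ℝ) + 1)}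
      rw [this]
      exact measurableSet_ball
    · exact measurableSet_lt measurable_const hΦ
  · exact (Nat.find_spec (hex m x)).resolve_left (not_not.2 hx)

/-- The lower semicontinuous envelope along `Ω`. -/
def lowerEnv (Ω : Set X) (F : X → ℝ≥0∞) (x : X) : ℝ≥0∞ :=
  ⨆ m : ℕ, ⨅ z ∈ Ω ∩ ball x (1 / ((m : ℝ) + 1)), F z

lemma measurable_lowerEnv (Ω : Set X) (F : X → ℝ≥0∞) : Measurable (lowerEnv Ω F) := by
  refine Measurable.iSup fun m => measurable_of_Iio fun c => ?_
  have : (fun x => ⨅ z ∈ Ω ∩ ball x (1 / ((m : ℝ) + 1)), F z) ⁻¹' Iio c =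
      ⋃ z ∈ {z ∈ Ω | F z < c}, ball z (1 / ((m : ℝ) + 1)) := by
    ext x
    simp only [mem_preimage, mem_Iio, iInf_lt_iff, mem_iUnion, mem_inter_iff, mem_ball, exists_prop,
      mem_ofPred_eq, dist_comm x]
    exact ⟨fun ⟨z, ⟨h1, h2⟩, h3⟩ => ⟨z, ⟨h1, h3⟩, h2⟩, fun ⟨z, ⟨h1, h2⟩, h3⟩ => ⟨z, ⟨h1, h3⟩, h2⟩⟩
  rw [this]
  exact (isOpen_biUnion fun _ _ => isOpen_ball).measurableSet

variable [SecondCountableTopology X] {μ : Measure X} [SigmaFinite μ] {Ω : Set X}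

lemma DoublingDomain.lintegral_lowerEnv_le (h : DoublingDomain μ Ω) : ∃ C : NNReal,
    ∀ (Z : Set X) (F : X → ℝ≥0∞), MeasurableSet Z → Z ⊆ closure Ω → Measurable F →
      ∫⁻ x in Z, lowerEnv Ω F x ∂μ ≤ C * ∫⁻ x in Ω, F x ∂μ := by
  obtain ⟨C, hC⟩ := h.lintegral_le 1
  refine ⟨C, fun Z F hZ hcl hF => hC Z _ F hZ (measurable_lowerEnv Ω F) hF fun x hx t ht => ?_⟩
  obtain ⟨m, hm⟩ := lt_iSup_iff.1 ht
  have hpos : (0 : ℝ) < 1 / ((m : ℝ) + 1) := by positivity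
  obtain ⟨y, hy, hxy⟩ := Metric.mem_closure_iff.1 (hcl hx) (1 / ((m : ℝ) + 1) / 2) (by positivity)
  refine ⟨y, hy, 1 / ((m : ℝ) + 1) / 2, by positivity, ?_, by linarith, fun z hz => ?_⟩
  · have : 1 / ((m : ℝ) + 1) ≤ 1 := by
      rw [div_le_one (by positivity)]
      have : (0 : ℝ) ≤ m := m.cast_nonneg
      linarith
    linarith
  · refine hm.trans_le (iInf₂_le z ⟨hz.2, ?_⟩)
    have h1 := dist_triangle z y x
    have h2 := mem_ball.1 hz.1
    rw [mem_ball]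
    rw [dist_comm x y] at hxy
    linarith

lemma HasModulus.exists_extension_closure (h : DoublingDomain μ Ω) {N : (ℝ → ℝ≥0∞) → ℝ≥0∞}
    {K : NNReal} (hN : IsCost N K) {p : ℝ} (hp : 0 < p) {S : Set X} (hS : MeasurableSet S)
    (hΩS : Ω ⊆ S) {u : X → ℝ} {w : X → ℝ → ℝ≥0∞} (hu : HasModulus S u w)
    (hfin : ∫⁻ x in S, energy N p u w x ∂μ ≠ ∞) :
    ∃ (S' : Set X) (u' : X → ℝ) (w' : X → ℝ → ℝ≥0∞), MeasurableSet S' ∧ S ⊆ S' ∧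
      μ (closure Ω \ S') = 0 ∧ HasModulus S' u' w' ∧ (∀ x ∈ S, u' x = u x) ∧
      ∫⁻ x in S', energy N p u' w' x ∂μ ≠ ∞ := by
  classical
  by_cases hX : Nonempty X
  swap
  · have : IsEmpty X := not_nonempty_iff.1 hX
    exact ⟨S, u, w, hS, le_rfl, by simp [eq_empty_of_isEmpty], hu, fun _ _ => rfl, hfin⟩
  set F := energy N p u w with hF
  have hFm : Measurable F := measurable_energy hN.measurable hu.1 hu.2
  obtain ⟨C, hC⟩ := h.lintegral_lowerEnv_le
  set Z := closure Ω \ S with hZdef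
  have hZ : MeasurableSet Z := isClosed_closure.measurableSet.diff hS
  have hEm := measurable_lowerEnv Ω F
  have hEfin : ∫⁻ x in Z, lowerEnv Ω F x ∂μ ≠ ∞ := by
    refine ne_top_of_le_ne_top ?_ (hC Z F hZ sdiff_subset hFm)
    refine ENNReal.mul_ne_top ENNReal.coe_ne_top (ne_top_of_le_ne_top hfin ?_)
    exact lintegral_mono_set hΩS
  obtain ⟨η, hη0, hηm, hη⟩ := exists_pos_lintegral_lt_of_sigmaFinite μ one_ne_zero
  set B : X → ℝ≥0∞ := fun x => lowerEnv Ω F x + η x with hB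
  have hBm : Measurable B := hEm.add hηm.coe_nnreal_ennreal
  have hBfin : ∫⁻ x in Z, B x ∂μ ≠ ∞ := by
    rw [lintegral_add_left hEm]
    refine ENNReal.add_ne_top.2 ⟨hEfin, ne_top_of_le_ne_top (hη.trans one_lt_top).ne ?_⟩
    exact setLIntegral_le_lintegral _ _
  set Z' := Z ∩ {x | B x < ∞} with hZ'def
  have hZ' : MeasurableSet Z' := hZ.inter (measurableSet_lt hBm measurable_const)
  have hnull : μ (Z \ Z') = 0 := by
    have := ae_lt_top hBm hBfin
    rw [ae_restrict_iff' hZ, ae_iff] at this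
    refine measure_mono_null (fun x hx => ?_) this
    intro hcon
    exact hx.2 ⟨hx.1, hcon hx.1⟩
  have hne : ∀ x ∈ Z', ∀ r > 0, ∃ z ∈ Ω, dist z x < r ∧ F z < B x := by
    intro x hx r hr
    obtain ⟨m, hm⟩ := exists_nat_one_div_lt hr
    have h1 : (⨅ z ∈ Ω ∩ ball x (1 / ((m : ℝ) + 1)), F z) < B x := by
      refine (le_iSup (fun m : ℕ => ⨅ z ∈ Ω ∩ ball x (1 / ((m : ℝ) + 1)), F z) m).trans_lt ?_
      refine ENNReal.lt_add_right ?_ (by exact_mod_cast (hη0 x).ne')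
      exact ((le_self_add).trans_lt hx.2).ne
    simp only [iInf_lt_iff] at h1
    obtain ⟨z, hz, hzF⟩ := h1
    exact ⟨z, hz.1, (mem_ball.1 hz.2).trans hm, hzF⟩
  obtain ⟨e, idx, hidx, happ⟩ := exists_measurable_approx hBm hZ' hne
  set zz : ℕ → X → X := fun m x => if x ∈ S then x else e (idx m x) with hzz
  have hzzm : ∀ {Y : Type} [MeasurableSpace Y] (f : X → Y), Measurable f →
      ∀ m, Measurable fun x => f (zz m x) := by
    intro Y _ f hf m
    have : (fun x => f (zz m x)) = fun x => if x ∈ S then f x else f (e (idx m x)) := by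
      funext x; simp only [hzz]; split_ifs <;> rfl
    rw [this]
    exact Measurable.ite hS hf ((measurable_from_nat (f := fun n => f (e n))).comp (hidx m))
  have hzS : ∀ x ∈ S, ∀ m, zz m x = x := fun x hx m => if_pos hx
  have hzZ : ∀ x ∈ Z', ∀ m : ℕ, zz m x ∈ Ω ∧ dist (zz m x) x < 1 / ((m : ℝ) + 1) ∧
      F (zz m x) < B x := by
    intro x hx m
    have : zz m x = e (idx m x) := if_neg hx.1.2
    rw [this]
    exact happ m x hx
  have hmem : ∀ x ∈ S ∪ Z', ∀ m : ℕ, zz m x ∈ S ∧ dist (zz m x) x < 1 / ((m : ℝ) + 1) := by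
    rintro x (hx | hx) m
    · rw [hzS x hx m, dist_self]
      exact ⟨hx, by positivity⟩
    · exact ⟨hΩS (hzZ x hx m).1, (hzZ x hx m).2.1⟩
  set u' : X → ℝ := fun x => limsup (fun m => u (zz m x)) atTop with hu'
  set w' : X → ℝ → ℝ≥0∞ := fun x t => liminf (fun m => w (zz m x) t) atTop with hw'
  have hnear : ∀ x ∈ S ∪ Z', ∀ r > 0, ∀ᶠ m : ℕ in atTop, dist (zz m x) x < r := by
    intro x hx r hr
    have := (tendsto_order.1 (tendsto_one_div_add_atTop_nhds_zero_nat (𝕜 := ℝ))).2 r hr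
    exact this.mono fun m hm => (hmem x hx m).2.trans hm
  have hNw : ∀ x ∈ Z', ∀ m, N (w (zz m x)) ≤ B x ^ p⁻¹ := by
    intro x hx m
    rw [ENNReal.le_rpow_inv_iff hp]
    exact le_self_add.trans (hzZ x hx m).2.2.le
  have hconv : ∀ x ∈ S ∪ Z', Tendsto (fun m => u (zz m x)) atTop (𝓝 (u' x)) := by
    intro x hx
    suffices ∃ a, Tendsto (fun m => u (zz m x)) atTop (𝓝 a) by
      obtain ⟨a, ha⟩ := this
      have : u' x = a := ha.limsup_eq
      rwa [this]
    rcases hx with hx | hx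
    · exact ⟨u x, by simp only [hzS x hx]; exact tendsto_const_nhds⟩
    refine cauchySeq_tendsto_of_complete (EMetric.cauchySeq_iff.2 fun ε hε => ?_)
    set b : ℝ≥0∞ := B x ^ p⁻¹ with hb
    have hbt : b ≠ ∞ := ENNReal.rpow_ne_top_of_nonneg (inv_nonneg.2 hp.le) hx.2.ne
    obtain ⟨δ, hδ0, hδ⟩ : ∃ δ : NNReal, 0 < δ ∧ δ * b + δ * b < ε := by
      obtain ⟨δ, hδ0, hδ⟩ := ENNReal.exists_nnreal_pos_mul_lt (a := b + b)
        (ENNReal.add_ne_top.2 ⟨hbt, hbt⟩) hε.ne'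
      exact ⟨δ, hδ0, by rwa [← mul_add]⟩
    obtain ⟨t, ht0, ht⟩ := hN.small δ hδ0
    obtain ⟨M, hM⟩ := eventually_atTop.1 (hnear x (Or.inr hx) (t / 2) (half_pos ht0))
    refine ⟨M, fun m hm n hn => ?_⟩
    have hd : dist (zz m x) (zz n x) < t := by
      have := dist_triangle_right (zz m x) (zz n x) x
      linarith [hM m hm, hM n hn]
    have hle : ∀ m, w (zz m x) t ≤ δ * b := fun m =>
      (ht _).trans (by gcongr; exact hNw x hx m)
    exact (hu.edist_le _ (hmem x (Or.inr hx) m).1 _ (hmem x (Or.inr hx) n).1 t ht0 hd).trans_lt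
      ((add_le_add (hle m) (hle n)).trans_lt hδ)
  have hS' : MeasurableSet (S ∪ Z') := hS.union hZ'
  refine ⟨S ∪ Z', u', w', hS', subset_union_left, ?_, ⟨?_, ?_, ?_⟩, ?_, ?_⟩
  · refine measure_mono_null (fun x hx => ?_) hnull
    exact ⟨⟨hx.1, fun hxS => hx.2 (Or.inl hxS)⟩, fun hxZ => hx.2 (Or.inr hxZ)⟩
  · exact Measurable.limsup fun m => hzzm u hu.1 m
  · exact fun t => Measurable.liminf fun m => hzzm _ (hu.2 t) m
  · intro x hx y hy t ht hxy
    rw [edist_comm, add_comm]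
    refine edist_le_liminf_add (hconv y hy) ?_
    filter_upwards [hnear y hy _ (half_pos (sub_pos.2 hxy))] with l hl
    rw [edist_comm, add_comm]
    refine edist_le_liminf_add (hconv x hx) ?_
    filter_upwards [hnear x hx _ (half_pos (sub_pos.2 hxy))] with m hm
    refine hu.edist_le _ (hmem x hx m).1 _ (hmem y hy l).1 t ht ?_
    have h1 := dist_triangle (zz m x) x (zz l y)
    have h2 := dist_triangle_right x (zz l y) y
    linarith
  · intro x hx
    simp [hu', hzS x hx]
  · refine ne_top_of_le_ne_top ?_ (lintegral_union_le _ _ _)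
    refine ENNReal.add_ne_top.2 ⟨?_, ?_⟩
    · have : ∫⁻ x in S, energy N p u' w' x ∂μ = ∫⁻ x in S, energy N p u w x ∂μ := by
        refine setLIntegral_congr_fun hS fun x hx => ?_
        simp [energy, hu', hw', hzS x hx]
      rwa [this]
    · have hle : ∫⁻ x in Z', energy N p u' w' x ∂μ ≤ ∫⁻ x in Z', (B x + B x) ∂μ := by
        refine setLIntegral_mono' hZ' fun x hx => add_le_add ?_ ?_
        · rw [← ENNReal.le_rpow_inv_iff hp]
          refine (hN.liminf_le _).trans (liminf_le_of_frequently_le' ?_)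
          exact Frequently.of_forall (hNw x hx)
        · refine le_of_tendsto (((hconv x (Or.inr hx)).enorm).ennrpow_const p)
            (Eventually.of_forall fun m => ?_)
          exact le_add_self.trans (hzZ x hx m).2.2.le
      refine ne_top_of_le_ne_top ?_ (hle.trans (lintegral_mono_set inter_subset_left))
      rw [lintegral_add_left hBm]
      exact ENNReal.add_ne_top.2 ⟨hBfin, hBfin⟩

end

/-- The points at positive distance less than one from `Ω`. -/
def collar {X : Type*} [PseudoMetricSpace X] (Ω : Set X) : Set X :=
  {x | 0 < infDist x Ω ∧ infDist x Ω < 1}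

lemma isOpen_collar {X : Type*} [PseudoMetricSpace X] (Ω : Set X) : IsOpen (collar Ω) :=
  (isOpen_lt continuous_const (continuous_infDist_pt Ω)).inter
    (isOpen_lt (continuous_infDist_pt Ω) continuous_const)

lemma measurable_sum_finset {X ι : Type*} [MeasurableSpace X] [Countable ι] {f : ι → X → ℝ}
    (hf : ∀ i, Measurable (f i)) {J : X → Finset ι} (hJ : ∀ x, ∀ i ∉ J x, f i x = 0) :
    Measurable fun x => ∑ i ∈ J x, f i x := by
  refine measurable_of_tendsto_metrizable' (atTop : Filter (Finset ι))
    (f := fun s x => ∑ i ∈ s, f i x) (fun s => Finset.measurable_fun_sum s fun i _ => hf i) ?_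
  rw [tendsto_pi_nhds]
  intro x
  have : HasSum (fun i => f i x) (∑ i ∈ J x, f i x) := hasSum_sum_of_ne_finset_zero (hJ x)
  simpa only [HasSum, SummationFilter.unconditional_filter] using this

section

variable {X : Type*} [PseudoMetricSpace X] {Ω : Set X}

lemma infDist_bounds {x y : X} (h : dist x y < infDist y Ω / 2) :
    infDist y Ω < 2 * infDist x Ω ∧ 2 / 3 * infDist x Ω ≤ infDist y Ω := by
  have h1 := infDist_le_infDist_add_dist (s := Ω) (x := x) (y := y)
  have h2 := infDist_le_infDist_add_dist (s := Ω) (x := y) (y := x)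
  rw [dist_comm y x] at h2
  constructor <;> linarith

variable [MeasurableSpace X] [OpensMeasurableSpace X] [SecondCountableTopology X] {μ : Measure X}

lemma DoublingDomain.exists_whitney_cover (h : DoublingDomain μ Ω) :
    ∃ (I : Set X) (J : X → Finset I) (n : ℕ), I.Countable ∧ I ⊆ collar Ω ∧
      (∀ x i, i ∈ J x ↔ x ∈ collar Ω ∧ dist x i < infDist (i : X) Ω / 2) ∧
      (∀ x, (J x).card ≤ n) ∧
      (∀ x ∈ collar Ω, ∃ i : I, dist x i ≤ infDist (i : X) Ω / 4) := by
  classical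
  obtain ⟨I, hIA, hdisj, hcov⟩ := Vitali.exists_disjoint_subfamily_covering_enlargement_closedBall
    (collar Ω) id (fun x => infDist x Ω / 20) (1 / 20) (fun a ha => by
      have := ha.2; linarith) 5 (by norm_num)
  simp only [id] at hdisj hcov
  have hcount : I.Countable := hdisj.countable_of_nonempty_interior fun a ha => by
    have h0 : 0 < infDist a Ω / 20 := by have := (hIA ha).1; linarith
    exact ⟨a, ball_subset_interior_closedBall (mem_ball_self h0)⟩
  obtain ⟨C, hC⟩ := h.doubling 90
  have hcard : ∀ x ∈ collar Ω, ∀ s : Finset I,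
      (∀ i ∈ s, dist x i < infDist (i : X) Ω / 2) → (s.card : ℝ≥0∞) ≤ C := by
    intro x hx s hs
    set δ := infDist x Ω with hδ
    have hδ0 : 0 < δ := hx.1
    set V := μ (ball x (2 * δ)) with hV
    have hV0 : V ≠ 0 := (h.ball_pos x _ (by linarith)).ne'
    have hVt : V ≠ ∞ := (h.ball_lt_top x _).ne
    have hsub : ∀ i ∈ s, ball (i : X) (δ / 30) ⊆ ball x (2 * δ) := fun i hi => by
      have := infDist_bounds (hs i hi)
      have h1 := hs i hi
      refine ball_subset_ball' ?_
      rw [dist_comm] at h1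
      linarith
    have hsup : ∀ i ∈ s, V ≤ C * μ (ball (i : X) (δ / 30)) := fun i hi => by
      have := infDist_bounds (hs i hi)
      have h1 := hs i hi
      refine (measure_mono (ball_subset_ball' ?_)).trans (hC i (δ / 30) (by positivity))
      linarith
    have hdis : (s : Set I).PairwiseDisjoint fun i : I => ball (i : X) (δ / 30) := by
      intro i hi j hj hij
      have hd := hdisj i.2 j.2 (fun hcon => hij (Subtype.ext hcon))
      have hsm : ∀ k ∈ s, ball (k : X) (δ / 30) ⊆ closedBall (k : X) (infDist (k : X) Ω / 20) := by
        intro k hk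
        have := infDist_bounds (hs k hk)
        exact ball_subset_closedBall.trans (closedBall_subset_closedBall (by linarith))
      exact hd.mono (hsm i hi) (hsm j hj)
    have key : (s.card : ℝ≥0∞) * V ≤ C * V := by
      calc (s.card : ℝ≥0∞) * V = ∑ i ∈ s, V := by rw [Finset.sum_const, nsmul_eq_mul]
        _ ≤ ∑ i ∈ s, C * μ (ball (i : X) (δ / 30)) := Finset.sum_le_sum hsup
        _ = C * ∑ i ∈ s, μ (ball (i : X) (δ / 30)) := by rw [Finset.mul_sum]
        _ = C * μ (⋃ i ∈ s, ball (i : X) (δ / 30)) := by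
            rw [measure_biUnion_finset hdis fun _ _ => measurableSet_ball]
        _ ≤ C * V := by
            refine mul_le_mul_right (measure_mono ?_) _
            exact iUnion₂_subset hsub
    exact (ENNReal.mul_le_mul_iff_left hV0 hVt).1 key
  have hcard' : ∀ x ∈ collar Ω, ∀ s : Finset I,
      (∀ i ∈ s, dist x i < infDist (i : X) Ω / 2) → s.card ≤ ⌊C⌋₊ := fun x hx s hs => by
    refine Nat.le_floor ?_
    have := hcard x hx s hs
    exact_mod_cast this
  have hfin : ∀ x ∈ collar Ω, {i : I | dist x i < infDist (i : X) Ω / 2}.Finite := by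
    intro x hx
    by_contra hinf
    obtain ⟨s, hs, hsc⟩ := Set.Infinite.exists_subset_card_eq hinf (⌊C⌋₊ + 1)
    have := hcard' x hx s fun i hi => hs hi
    omega
  refine ⟨I, fun x => if hx : x ∈ collar Ω then (hfin x hx).toFinset else ∅, ⌊C⌋₊, hcount, hIA,
    fun x i => ?_, fun x => ?_, fun x hx => ?_⟩
  · by_cases hx : x ∈ collar Ω <;> simp [hx]
  · by_cases hx : x ∈ collar Ω
    · simp only [hx, dif_pos]
      exact hcard' x hx _ fun i hi => by simpa using hi
    · simp [hx]
  · obtain ⟨b, hb, hsub⟩ := hcov x hx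
    refine ⟨⟨b, hb⟩, ?_⟩
    have := hsub (mem_closedBall_self (by have := hx.1; linarith))
    rw [mem_closedBall] at this
    simp only
    linarith

/-- A Lipschitz partition of unity subordinate to a Whitney cover of the collar. -/
lemma DoublingDomain.exists_partition (h : DoublingDomain μ Ω) :
    ∃ (I : Set X) (J : X → Finset I) (n : ℕ) (a : I → X → ℝ) (C : ℝ), I.Countable ∧
      I ⊆ collar Ω ∧
      (∀ x i, i ∈ J x ↔ x ∈ collar Ω ∧ dist x i < infDist (i : X) Ω / 2) ∧
      (∀ x, (J x).card ≤ n) ∧ (∀ i, Measurable (a i)) ∧ (∀ i x, 0 ≤ a i x) ∧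
      (∀ x, ∀ i ∉ J x, a i x = 0) ∧ (∀ x ∈ collar Ω, ∑ i ∈ J x, a i x = 1) ∧ 0 ≤ C ∧
      ∀ x ∈ collar Ω, ∀ y ∈ collar Ω, ∀ i,
        |a i x - a i y| * min (infDist x Ω) (infDist y Ω) ≤ C * dist x y := by
  classical
  obtain ⟨I, J, n, hcount, hIA, hJ, hn, hcov⟩ := h.exists_whitney_cover
  have : Countable I := hcount.to_subtype
  set ψ : I → X → ℝ := fun i x => max 0 (min 1 (2 - dist x i * (4 / infDist (i : X) Ω))) with hψ
  set φ : I → X → ℝ := fun i => (collar Ω).indicator (ψ i) with hφ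
  have hδ : ∀ i : I, 0 < infDist (i : X) Ω := fun i => (hIA i.2).1
  have hψ0 : ∀ i x, 0 ≤ ψ i x := fun i x => le_max_left _ _
  have hφ0 : ∀ i x, 0 ≤ φ i x := fun i x => indicator_nonneg (fun x _ => hψ0 i x) x
  have hφJ : ∀ x, ∀ i ∉ J x, φ i x = 0 := by
    intro x i hi
    by_cases hx : x ∈ collar Ω
    · have h1 : infDist (i : X) Ω / 2 ≤ dist x i := not_lt.1 fun hcon => hi ((hJ x i).2 ⟨hx, hcon⟩)
      have h2 : 2 - dist x i * (4 / infDist (i : X) Ω) ≤ 0 := by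
        have : infDist (i : X) Ω / 2 * (4 / infDist (i : X) Ω) = 2 := by
          field_simp [(hδ i).ne']; norm_num
        have := mul_le_mul_of_nonneg_right h1 (div_nonneg (by norm_num : (0 : ℝ) ≤ 4) (hδ i).le)
        linarith
      simp only [hφ, indicator_of_mem hx, hψ]
      exact max_eq_left ((min_le_right _ _).trans h2)
    · exact indicator_of_notMem hx _
  have hφm : ∀ i, Measurable (φ i) := fun i => by
    refine Measurable.indicator ?_ (isOpen_collar Ω).measurableSet
    have : Continuous (ψ i) := by fun_prop
    exact this.measurable
  set S : X → ℝ := fun x => ∑ i ∈ J x, φ i x with hS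
  have hSm : Measurable S := measurable_sum_finset hφm hφJ
  have hS1 : ∀ x ∈ collar Ω, 1 ≤ S x := by
    intro x hx
    obtain ⟨i, hi⟩ := hcov x hx
    have hiJ : i ∈ J x := (hJ x i).2 ⟨hx, by have := hδ i; linarith⟩
    have : φ i x = 1 := by
      have : dist x i * (4 / infDist (i : X) Ω) ≤ 1 := by
        have h3 : infDist (i : X) Ω / 4 * (4 / infDist (i : X) Ω) = 1 := by
          field_simp [(hδ i).ne']
        have := mul_le_mul_of_nonneg_right hi (div_nonneg (by norm_num : (0 : ℝ) ≤ 4) (hδ i).le)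
        linarith
      simp only [hφ, indicator_of_mem hx, hψ]
      rw [min_eq_left (by linarith)]
      simp
    rw [← this]
    exact Finset.single_le_sum (f := fun i => φ i x) (fun i _ => hφ0 i x) hiJ
  have hS0 : ∀ x, 0 ≤ S x := fun x => Finset.sum_nonneg fun i _ => hφ0 i x
  have hSsup : ∀ x, ∀ s : Finset I, J x ⊆ s → S x = ∑ i ∈ s, φ i x := fun x s hs =>
    Finset.sum_subset hs fun i _ hi => hφJ x i hi
  have hlip : ∀ x ∈ collar Ω, ∀ y ∈ collar Ω, ∀ i,
      |φ i x - φ i y| * min (infDist x Ω) (infDist y Ω) ≤ 6 * dist x y := by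
    intro x hx y hy i
    by_cases hi : i ∈ J x ∪ J y
    · have h1 : 2 / 3 * min (infDist x Ω) (infDist y Ω) ≤ infDist (i : X) Ω := by
        rcases Finset.mem_union.1 hi with hi | hi
        · have := infDist_bounds ((hJ x i).1 hi).2
          linarith [min_le_left (infDist x Ω) (infDist y Ω)]
        · have := infDist_bounds ((hJ y i).1 hi).2
          linarith [min_le_right (infDist x Ω) (infDist y Ω)]
      have h2 : |φ i x - φ i y| ≤ dist x y * (4 / infDist (i : X) Ω) := by
        simp only [hφ, indicator_of_mem hx, indicator_of_mem hy, hψ]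
        refine (abs_max_sub_max_le_max _ _ _ _).trans ?_
        rw [sub_self, abs_zero, max_eq_right (abs_nonneg _)]
        refine (abs_min_sub_min_le_max _ _ _ _).trans ?_
        rw [sub_self, abs_zero, max_eq_right (abs_nonneg _), show ∀ a b c : ℝ, 2 - a * c - (2 - b * c) = (b - a) * c by
            intros; ring,
          abs_mul, abs_of_nonneg (a := 4 / infDist (i : X) Ω) (div_nonneg (by norm_num) (hδ i).le)]
        refine mul_le_mul_of_nonneg_right ?_ (div_nonneg (by norm_num) (hδ i).le)
        rw [abs_sub_comm]
        exact abs_dist_sub_le x y i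
      calc |φ i x - φ i y| * min (infDist x Ω) (infDist y Ω)
          ≤ dist x y * (4 / infDist (i : X) Ω) * (3 / 2 * infDist (i : X) Ω) := by
            refine mul_le_mul h2 (by linarith) (le_min hx.1.le hy.1.le) ?_
            exact mul_nonneg dist_nonneg (div_nonneg (by norm_num) (hδ i).le)
        _ = 6 * dist x y := by
            field_simp [(hδ i).ne']; ring
    · rw [Finset.mem_union, not_or] at hi
      rw [hφJ x i hi.1, hφJ y i hi.2]
      simp only [sub_self, abs_zero, zero_mul]
      positivity
  refine ⟨I, J, n, fun i x => φ i x / S x, 6 * (1 + 2 * n), hcount, hIA, hJ, hn,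
    fun i => (hφm i).div hSm, fun i x => div_nonneg (hφ0 i x) (hS0 x),
    fun x i hi => by simp [hφJ x i hi], fun x hx => ?_, by positivity, fun x hx y hy i => ?_⟩
  · rw [← Finset.sum_div]
    exact div_self (by linarith [hS1 x hx])
  · set m := min (infDist x Ω) (infDist y Ω) with hm
    have hm0 : 0 < m := lt_min hx.1 hy.1
    have hSx := hS1 x hx
    have hSy := hS1 y hy
    have hSd : |S x - S y| * m ≤ 2 * n * (6 * dist x y) := by
      rw [hSsup x (J x ∪ J y) Finset.subset_union_left, hSsup y (J x ∪ J y) Finset.subset_union_right,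
        ← Finset.sum_sub_distrib]
      calc |∑ i ∈ J x ∪ J y, (φ i x - φ i y)| * m
          ≤ (∑ i ∈ J x ∪ J y, |φ i x - φ i y|) * m := by
            gcongr; exact Finset.abs_sum_le_sum_abs _ _
        _ = ∑ i ∈ J x ∪ J y, |φ i x - φ i y| * m := Finset.sum_mul _ _ _
        _ ≤ ∑ i ∈ J x ∪ J y, 6 * dist x y := Finset.sum_le_sum fun i _ => hlip x hx y hy i
        _ = ((J x ∪ J y).card : ℝ) * (6 * dist x y) := by rw [Finset.sum_const, nsmul_eq_mul]
        _ ≤ 2 * n * (6 * dist x y) := by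
            gcongr
            have : (J x ∪ J y).card ≤ 2 * n := by
              have := Finset.card_union_le (J x) (J y)
              have := hn x
              have := hn y
              omega
            exact_mod_cast this
    have hφS : φ i y / S y ≤ 1 := by
      rw [div_le_one (by linarith)]
      by_cases hi : i ∈ J y
      · exact Finset.single_le_sum (f := fun i => φ i y) (fun i _ => hφ0 i y) hi
      · rw [hφJ y i hi]; exact hS0 y
    have hid : φ i x / S x - φ i y / S y =
        (φ i x - φ i y) / S x - φ i y / S y * ((S x - S y) / S x) := by
      field_simp
      ring
    have h1 : |φ i x / S x - φ i y / S y| ≤ |φ i x - φ i y| + |S x - S y| := by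
      rw [hid]
      refine (abs_sub _ _).trans (add_le_add ?_ ?_)
      · rw [abs_div, abs_of_nonneg (hS0 x)]
        exact div_le_self (abs_nonneg _) hSx
      · rw [abs_mul, abs_of_nonneg (div_nonneg (hφ0 i y) (hS0 y)), abs_div,
          abs_of_nonneg (hS0 x)]
        exact (mul_le_of_le_one_left (by positivity) hφS).trans
          (div_le_self (abs_nonneg _) hSx)
    calc |φ i x / S x - φ i y / S y| * m ≤ (|φ i x - φ i y| + |S x - S y|) * m := by gcongr
      _ = |φ i x - φ i y| * m + |S x - S y| * m := add_mul _ _ _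
      _ ≤ 6 * dist x y + 2 * n * (6 * dist x y) := add_le_add (hlip x hx y hy i) hSd
      _ = 6 * (1 + 2 * n) * dist x y := by ring

end

lemma edist_sum_mul_le {ι : Type*} {s : Finset ι} {a z : ι → ℝ} {b : ℝ} {M : ℝ≥0∞}
    (ha : ∀ i ∈ s, 0 ≤ a i) (h1 : ∑ i ∈ s, a i = 1) (hz : ∀ i ∈ s, edist (z i) b ≤ M) :
    edist (∑ i ∈ s, a i * z i) b ≤ M := by
  induction M with
  | top => exact le_top
  | coe M =>
    simp only [edist_le_coe, ← NNReal.coe_le_coe, coe_nndist] at hz ⊢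
    exact (convex_closedBall b (M : ℝ)).sum_mem ha h1 hz

lemma IsCost.sum_le {N : (ℝ → ℝ≥0∞) → ℝ≥0∞} {K : NNReal} (hN : IsCost N K) {ι : Type*}
    (s : Finset ι) (w : ι → ℝ → ℝ≥0∞) :
    N (fun t => ∑ i ∈ s, w i t) ≤ (K + 1) ^ s.card * ∑ i ∈ s, N (w i) := by
  classical
  induction s using Finset.induction_on with
  | empty =>
    have := hN.const_mul_le 0 (fun _ => 0)
    simpa using this
  | insert i s hi ih =>
    simp only [Finset.sum_insert hi, Finset.card_insert_of_notMem hi]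
    refine (hN.add_le _ _).trans ?_
    have h1 : (1 : ℝ≥0∞) ≤ (K + 1) ^ s.card := one_le_pow₀ le_add_self
    calc K * (N (w i) + N fun t => ∑ j ∈ s, w j t)
        ≤ (K + 1) * ((K + 1) ^ s.card * N (w i) + (K + 1) ^ s.card * ∑ j ∈ s, N (w j)) := by
          gcongr
          · exact le_self_add
          · exact le_mul_of_one_le_left' h1
      _ = _ := by ring

/-- Moduli that are monotone in the scale and grow at most linearly. -/
structure IsRegularModulus {X : Type*} (w : X → ℝ → ℝ≥0∞) : Prop where
  mono : ∀ x s t, 0 < s → s ≤ t → w x s ≤ w x t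
  scale : ∀ x (k t : ℝ), 1 ≤ k → 0 < t → w x (k * t) ≤ ENNReal.ofReal k * w x t

lemma IsRegularModulus.le_mul {X : Type*} {w : X → ℝ → ℝ≥0∞} (hw : IsRegularModulus w) (x : X)
    {k s t : ℝ} (hk : 1 ≤ k) (ht : 0 < t) (hs : 0 < s) (hst : s ≤ k * t) :
    w x s ≤ ENNReal.ofReal k * w x t :=
  (hw.mono x s _ hs hst).trans (hw.scale x k t hk ht)

section

variable {X : Type*} [PseudoMetricSpace X] [MeasurableSpace X] [OpensMeasurableSpace X]
  [SecondCountableTopology X] {μ : Measure X} [SigmaFinite μ] {Ω : Set X}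

/-- Choice of almost minimising points in the reflected Whitney balls. -/
lemma DoublingDomain.exists_reflection (h : DoublingDomain μ Ω) (hΩ : Ω.Nonempty) {I : Set X}
    (hI : I.Countable) (hIA : I ⊆ collar Ω) {F : X → ℝ≥0∞} (hF : Measurable F)
    (hfin : ∫⁻ x in Ω, F x ∂μ ≠ ∞) :
    ∃ (z : I → X) (B : X → ℝ≥0∞), (∀ i, z i ∈ Ω ∧ dist (i : X) (z i) < 3 * infDist (i : X) Ω) ∧
      Measurable B ∧ ∫⁻ x in collar Ω, B x ∂μ ≠ ∞ ∧
      ∀ (x : X) (i : I), dist x i < infDist (i : X) Ω / 2 → F (z i) ≤ B x := by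
  have : Countable I := hI.to_subtype
  have hδ : ∀ i : I, 0 < infDist (i : X) Ω := fun i => (hIA i.2).1
  have hp : ∀ i : I, ∃ y ∈ Ω, dist (i : X) y < 2 * infDist (i : X) Ω := fun i =>
    (infDist_lt_iff hΩ).1 (by linarith [hδ i])
  choose P hPΩ hPd using hp
  set m : I → ℝ≥0∞ := fun i => ⨅ y ∈ ball (P i) (infDist (i : X) Ω) ∩ Ω, F y with hm
  set U : I → Set X := fun i => ball (i : X) (infDist (i : X) Ω / 2) with hU
  have hUm : ∀ i, MeasurableSet (U i) := fun i => measurableSet_ball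
  obtain ⟨ε', hε'0, hε'⟩ := ENNReal.exists_pos_sum_of_countable' one_ne_zero I
  set ε : I → ℝ≥0∞ := fun i => ε' i / μ (U i) with hε
  have hε0 : ∀ i, ε i ≠ 0 := fun i =>
    (ENNReal.div_pos (hε'0 i).ne' (h.ball_lt_top _ _).ne).ne'
  have hz : ∀ i, ∃ y ∈ ball (P i) (infDist (i : X) Ω) ∩ Ω, F y ≤ m i + ε i := by
    intro i
    have hPi : P i ∈ ball (P i) (infDist (i : X) Ω) ∩ Ω := ⟨mem_ball_self (hδ i), hPΩ i⟩
    by_cases hmi : m i = ∞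
    · exact ⟨P i, hPi, by simp [hmi]⟩
    · have : m i < m i + ε i := ENNReal.lt_add_right hmi (hε0 i)
      conv_lhs at this => rw [hm]
      simp only [iInf_lt_iff] at this
      obtain ⟨y, hy, hlt⟩ := this
      exact ⟨y, hy, hlt.le⟩
  choose z hzm hzF using hz
  set Φ : X → ℝ≥0∞ := fun x => ⨆ i, (U i).indicator (fun _ => m i) x with hΦ
  set E : X → ℝ≥0∞ := fun x => ∑' i, (U i).indicator (fun _ => ε i) x with hE
  have hΦm : Measurable Φ := Measurable.iSup fun i => measurable_const.indicator (hUm i)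
  have hEm : Measurable E := Measurable.tsum fun i => measurable_const.indicator (hUm i)
  obtain ⟨C, hC⟩ := h.lintegral_le 3
  have hΦfin : ∫⁻ x in collar Ω, Φ x ∂μ ≠ ∞ := by
    refine ne_top_of_le_ne_top (ENNReal.mul_ne_top ENNReal.coe_ne_top hfin)
      (hC _ _ _ (isOpen_collar Ω).measurableSet hΦm hF fun x hx t ht => ?_)
    obtain ⟨i, hi⟩ := lt_iSup_iff.1 ht
    have hxi : x ∈ U i := by
      by_contra hcon
      rw [indicator_of_notMem hcon] at hi
      simp at hi
    rw [indicator_of_mem hxi] at hi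
    have hd : dist x i < infDist (i : X) Ω / 2 := hxi
    refine ⟨P i, hPΩ i, infDist (i : X) Ω, hδ i, (hIA i.2).2.le, ?_, fun y hy =>
      hi.trans_le (iInf₂_le y hy)⟩
    have := dist_triangle x i (P i)
    linarith [hPd i, hδ i]
  have hEfin : ∫⁻ x in collar Ω, E x ∂μ ≠ ∞ := by
    refine ne_top_of_le_ne_top (hε'.trans one_lt_top).ne ?_
    refine (setLIntegral_le_lintegral _ _).trans ?_
    rw [lintegral_tsum fun i => (measurable_const.indicator (hUm i)).aemeasurable]
    refine ENNReal.tsum_le_tsum fun i => ?_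
    rw [lintegral_indicator_const (hUm i)]
    exact (ENNReal.div_mul_cancel (h.ball_pos _ _ (half_pos (hδ i))).ne' (h.ball_lt_top _ _).ne).le
  refine ⟨z, fun x => Φ x + E x, fun i => ⟨(hzm i).2, ?_⟩, hΦm.add hEm, ?_, fun x i hxi => ?_⟩
  · have h1 := mem_ball'.1 (hzm i).1
    have := dist_triangle (i : X) (P i) (z i)
    linarith [hPd i]
  · rw [lintegral_add_left hΦm]
    exact ENNReal.add_ne_top.2 ⟨hΦfin, hEfin⟩
  · have hxU : x ∈ U i := hxi
    refine (hzF i).trans (add_le_add ?_ ?_)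
    · refine le_trans ?_ (le_iSup _ i)
      rw [indicator_of_mem hxU]
    · refine le_trans ?_ (ENNReal.le_tsum i)
      rw [indicator_of_mem hxU]

end

section

variable {X : Type*} [PseudoMetricSpace X] [MeasurableSpace X] {Ω : Set X}

/-- The estimate for an average over a Whitney partition of unity at scales well below the
distance to `Ω`. -/
lemma edist_partition_le {I : Set X} {J : X → Finset I} {n : ℕ} {a : I → X → ℝ} {C : ℝ}
    (hJ : ∀ x i, i ∈ J x ↔ x ∈ collar Ω ∧ dist x i < infDist (i : X) Ω / 2)
    (hn : ∀ x, (J x).card ≤ n) (haJ : ∀ x, ∀ i ∉ J x, a i x = 0)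
    (ha1 : ∀ x ∈ collar Ω, ∑ i ∈ J x, a i x = 1) (hC : 0 ≤ C)
    (hlip : ∀ x ∈ collar Ω, ∀ y ∈ collar Ω, ∀ i,
      |a i x - a i y| * min (infDist x Ω) (infDist y Ω) ≤ C * dist x y)
    {z : I → X} (hz : ∀ i, z i ∈ Ω ∧ dist (i : X) (z i) < 3 * infDist (i : X) Ω)
    {u : X → ℝ} {w : X → ℝ → ℝ≥0∞} (hu : HasModulus Ω u w) (hw : IsRegularModulus w)
    {x y : X} (hx : x ∈ collar Ω) (hy : y ∈ collar Ω) {t : ℝ} (ht : 0 < t) (hxy : dist x y < t)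
    (hxt : 8 * t < infDist x Ω) :
    edist (∑ i ∈ J x, a i x * u (z i)) (∑ i ∈ J y, a i y * u (z i)) ≤
      (113 + Real.toNNReal (128 * n * C) : NNReal) *
        (∑ i ∈ J x, w (z i) t + ∑ i ∈ J y, w (z i) t) := by
  classical
  set R := ∑ i ∈ J x, w (z i) t + ∑ i ∈ J y, w (z i) t with hR
  by_cases hRt : R = ∞
  · rw [hRt, ENNReal.mul_top]
    · exact le_top
    · rw [ENNReal.coe_ne_zero]
      positivity
  have hδ : 0 < infDist x Ω := hx.1
  set δ := infDist x Ω with hδdef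
  have hyδ : |infDist y Ω - δ| ≤ t := by
    rw [abs_le]
    have h1 := infDist_le_infDist_add_dist (s := Ω) (x := x) (y := y)
    have h2 := infDist_le_infDist_add_dist (s := Ω) (x := y) (y := x)
    rw [dist_comm y x] at h2
    constructor <;> linarith
  rw [abs_le] at hyδ
  set s := J x ∪ J y with hs
  have hsum : ∀ x, J x ⊆ s → ∀ f : I → ℝ, ∑ i ∈ J x, a i x * f i = ∑ i ∈ s, a i x * f i :=
    fun x hxs f => Finset.sum_subset hxs fun i _ hi => by rw [haJ x i hi, zero_mul]
  have hsx := hsum x Finset.subset_union_left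
  have hsy := hsum y Finset.subset_union_right
  have hi₀ : ∃ i, i ∈ J x := by
    by_contra! hcon
    have := ha1 x hx
    rw [Finset.eq_empty_of_forall_notMem hcon] at this
    simp at this
  obtain ⟨i₀, hi₀⟩ := hi₀
  have hdz : ∀ i ∈ s, dist x (z i) < 8 * δ := by
    intro i hi
    have h1 := dist_triangle x i (z i)
    have h2 := (hz i).2
    rcases Finset.mem_union.1 hi with hi | hi
    · have h3 := ((hJ x i).1 hi).2
      have h4 := (infDist_bounds h3).1
      linarith
    · have h3 := ((hJ y i).1 hi).2
      have h4 := (infDist_bounds h3).1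
      have h5 := dist_triangle x y i
      linarith
  have hwR : ∀ i ∈ s, w (z i) t ≤ R := by
    intro i hi
    rcases Finset.mem_union.1 hi with hi | hi
    · exact (Finset.single_le_sum (f := fun i => w (z i) t) (fun _ _ => zero_le) hi).trans
        le_self_add
    · exact (Finset.single_le_sum (f := fun i => w (z i) t) (fun _ _ => zero_le) hi).trans
        le_add_self
  have hu1 : ∀ i ∈ s, |u (z i) - u (z i₀)| ≤ 32 * δ / t * R.toReal := by
    intro i hi
    have hi₀s : i₀ ∈ s := Finset.mem_union_left _ hi₀
    have hd : dist (z i) (z i₀) < 16 * δ := by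
      have := dist_triangle_left (z i) (z i₀) x
      linarith [hdz i hi, hdz i₀ hi₀s]
    have hk : 1 ≤ 16 * δ / t := by
      rw [le_div_iff₀ ht]; linarith
    have hle : ∀ j ∈ s, w (z j) (16 * δ) ≤ ENNReal.ofReal (16 * δ / t) * R := fun j hj => by
      refine (hw.le_mul (z j) hk ht (by linarith) (by field_simp; rfl)).trans ?_
      gcongr
      exact hwR j hj
    have h1 := (hu.edist_le _ (hz i).1 _ (hz i₀).1 _ (by linarith) hd).trans
      (add_le_add (hle i hi) (hle i₀ hi₀s))
    rw [← ENNReal.ofReal_toReal hRt, ← ENNReal.ofReal_mul (by linarith),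
      ← ENNReal.ofReal_add (by positivity) (by positivity), edist_dist,
      ENNReal.ofReal_le_ofReal_iff (by positivity), Real.dist_eq] at h1
    refine h1.trans (le_of_eq ?_)
    ring
  have ha : ∀ i, |a i x - a i y| ≤ 2 * C * t / δ := by
    intro i
    rw [le_div_iff₀ hδ]
    have h1 := hlip x hx y hy i
    have h2 : δ / 2 ≤ min δ (infDist y Ω) := le_min (by linarith) (by linarith)
    have h3 := mul_le_mul_of_nonneg_left h2 (abs_nonneg (a i x - a i y))
    have h4 : C * dist x y ≤ C * t := mul_le_mul_of_nonneg_left hxy.le hC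
    linarith
  have hdiff : ∑ i ∈ J x, a i x * u (z i) - ∑ i ∈ J y, a i y * u (z i) =
      ∑ i ∈ s, (a i x - a i y) * (u (z i) - u (z i₀)) := by
    have h1 : ∑ i ∈ s, a i x = 1 := by
      have := hsx fun _ => 1
      simp only [mul_one] at this
      rw [← this, ha1 x hx]
    have h2 : ∑ i ∈ s, a i y = 1 := by
      have := hsy fun _ => 1
      simp only [mul_one] at this
      rw [← this, ha1 y hy]
    have h3 : ∑ i ∈ s, (a i x - a i y) * (u (z i) - u (z i₀)) =
        (∑ i ∈ s, a i x * u (z i) - ∑ i ∈ s, a i y * u (z i)) -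
          (∑ i ∈ s, a i x - ∑ i ∈ s, a i y) * u (z i₀) := by
      simp only [sub_mul, mul_sub, Finset.sum_sub_distrib, Finset.sum_mul]
    rw [h3, h1, h2, hsx, hsy, sub_self, zero_mul, sub_zero]
  have hcard : (s.card : ℝ) ≤ 2 * n := by
    have : s.card ≤ 2 * n := by
      have := Finset.card_union_le (J x) (J y)
      rw [← hs] at this
      have := hn x
      have := hn y
      omega
    exact_mod_cast this
  have hfinal : dist (∑ i ∈ J x, a i x * u (z i)) (∑ i ∈ J y, a i y * u (z i)) ≤
      128 * n * C * R.toReal := by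
    rw [Real.dist_eq, hdiff]
    calc |∑ i ∈ s, (a i x - a i y) * (u (z i) - u (z i₀))|
        ≤ ∑ i ∈ s, |(a i x - a i y) * (u (z i) - u (z i₀))| := Finset.abs_sum_le_sum_abs _ _
      _ ≤ ∑ i ∈ s, 64 * C * R.toReal := by
          refine Finset.sum_le_sum fun i hi => ?_
          rw [abs_mul]
          refine (mul_le_mul (ha i) (hu1 i hi) (abs_nonneg _) (by positivity)).trans (le_of_eq ?_)
          field_simp
          ring
      _ = s.card * (64 * C * R.toReal) := by rw [Finset.sum_const, nsmul_eq_mul]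
      _ ≤ 2 * n * (64 * C * R.toReal) := by gcongr
      _ = 128 * n * C * R.toReal := by ring
  rw [edist_dist]
  refine (ENNReal.ofReal_le_ofReal hfinal).trans ?_
  rw [ENNReal.ofReal_mul (by positivity), ENNReal.ofReal_toReal hRt]
  gcongr
  exact ENNReal.coe_le_coe.2 le_add_self

variable [OpensMeasurableSpace X] [SecondCountableTopology X] {μ : Measure X} [SigmaFinite μ]

lemma HasModulus.exists_extension_collar (h : DoublingDomain μ Ω) (hΩ : Ω.Nonempty)
    {N : (ℝ → ℝ≥0∞) → ℝ≥0∞} {K : NNReal} (hN : IsCost N K) {p : ℝ} (hp : 0 < p)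
    {u : X → ℝ} {w : X → ℝ → ℝ≥0∞} (hu : HasModulus Ω u w) (hw : IsRegularModulus w)
    (hfin : ∫⁻ x in Ω, energy N p u w x ∂μ ≠ ∞) :
    ∃ (u' : X → ℝ) (w' : X → ℝ → ℝ≥0∞), HasModulus (Ω ∪ collar Ω) u' w' ∧
      (∀ x ∈ Ω, u' x = u x) ∧ ∫⁻ x in Ω ∪ collar Ω, energy N p u' w' x ∂μ ≠ ∞ := by
  classical
  obtain ⟨I, J, n, a, C, hI, hIA, hJ, hn, ham, ha0, haJ, ha1, hC, hlip⟩ := h.exists_partition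
  have : Countable I := hI.to_subtype
  have hFm := measurable_energy (p := p) hN.measurable hu.1 hu.2
  obtain ⟨z, B, hz, hBm, hBfin, hzB⟩ := h.exists_reflection hΩ hI hIA hFm hfin
  have hcm : MeasurableSet (collar Ω) := (isOpen_collar Ω).measurableSet
  have hΩm := h.measurableSet
  have hdisj : ∀ x ∈ Ω, x ∉ collar Ω := fun x hx hcon => by
    have := hcon.1
    rw [infDist_zero_of_mem hx] at this
    exact lt_irrefl _ this
  set v : X → ℝ := fun x => ∑ i ∈ J x, a i x * u (z i) with hv
  set T : X → ℝ → ℝ≥0∞ := fun x t => ∑ i ∈ J x, w (z i) t with hT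
  set D : NNReal := 113 + Real.toNNReal (128 * n * C) with hD
  have hD113 : (113 : ℝ≥0∞) ≤ D := by
    rw [hD]
    push_cast
    exact le_self_add
  have hdz : ∀ x, ∀ i ∈ J x, dist x (z i) < 7 * infDist x Ω := by
    intro x i hi
    have h1 := dist_triangle x i (z i)
    have h2 := (hz i).2
    have h3 := ((hJ x i).1 hi).2
    have h4 := (infDist_bounds h3).1
    linarith
  have hwT : ∀ x t, ∀ i ∈ J x, w (z i) t ≤ T x t := fun x t i hi =>
    Finset.single_le_sum (f := fun i => w (z i) t) (fun _ _ => zero_le) hi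
  have hmix : ∀ x ∈ collar Ω, ∀ y ∈ Ω, ∀ t, 0 < t → dist x y < t →
      edist (v x) (u y) ≤ D * (T x t + w y t) := by
    intro x hx y hy t ht hxy
    refine edist_sum_mul_le (fun i _ => ha0 i x) (ha1 x hx) fun i hi => ?_
    have hδ : infDist x Ω < t := (infDist_le_dist_of_mem hy).trans_lt hxy
    have hd : dist (z i) y < 113 * t := by
      have := dist_triangle_left (z i) y x
      linarith [hdz x i hi]
    refine (hu.edist_le _ (hz i).1 _ hy _ (by linarith) hd).trans ?_
    have h8 : ∀ x, w x (113 * t) ≤ D * w x t := fun x =>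
      (hw.scale x 113 t (by norm_num) ht).trans (by gcongr; simpa using hD113)
    rw [mul_add]
    exact add_le_add ((h8 _).trans (by gcongr; exact hwT x t i hi)) (h8 y)
  have hfar : ∀ x ∈ collar Ω, ∀ y ∈ collar Ω, ∀ t, 0 < t → dist x y < t →
      edist (v x) (v y) ≤ D * (T x t + T y t) := by
    intro x hx y hy t ht hxy
    by_cases hx8 : 8 * t < infDist x Ω
    · exact edist_partition_le hJ hn haJ ha1 hC hlip hz hu hw hx hy ht hxy hx8
    by_cases hy8 : 8 * t < infDist y Ω
    · rw [edist_comm, add_comm]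
      rw [dist_comm] at hxy
      exact edist_partition_le hJ hn haJ ha1 hC hlip hz hu hw hy hx ht hxy hy8
    rw [not_lt] at hx8 hy8
    refine edist_sum_mul_le (fun i _ => ha0 i x) (ha1 x hx) fun i hi => ?_
    rw [edist_comm]
    refine edist_sum_mul_le (fun j _ => ha0 j y) (ha1 y hy) fun j hj => ?_
    rw [edist_comm]
    have hd : dist (z i) (z j) < 113 * t := by
      have h1 := dist_triangle_left (z i) (z j) x
      have h2 := dist_triangle x y (z j)
      linarith [hdz x i hi, hdz y j hj]
    refine (hu.edist_le _ (hz i).1 _ (hz j).1 _ (by linarith) hd).trans ?_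
    have h8 : ∀ x, w x (113 * t) ≤ D * w x t := fun x =>
      (hw.scale x 113 t (by norm_num) ht).trans (by gcongr; simpa using hD113)
    rw [mul_add]
    exact add_le_add ((h8 _).trans (by gcongr; exact hwT x t i hi))
      ((h8 _).trans (by gcongr; exact hwT y t j hj))
  have hJm : ∀ i, MeasurableSet {x | i ∈ J x} := by
    intro i
    have : {x | i ∈ J x} = collar Ω ∩ ball (i : X) (infDist (i : X) Ω / 2) := by
      ext x; simp [hJ]
    rw [this]
    exact hcm.inter measurableSet_ball
  have hvm : Measurable v := measurable_sum_finset (fun i => (ham i).mul_const _)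
    fun x i hi => by rw [haJ x i hi, zero_mul]
  have hTm : ∀ t, Measurable fun x => T x t := by
    intro t
    have : (fun x => T x t) = fun x => ∑' i, {x | i ∈ J x}.indicator (fun _ => w (z i) t) x := by
      funext x
      rw [tsum_eq_sum (s := J x)]
      · exact Finset.sum_congr rfl fun i hi =>
          (indicator_of_mem (s := {x | i ∈ J x}) hi fun _ => w (z i) t).symm
      · exact fun i hi => indicator_of_notMem (s := {x | i ∈ J x}) hi fun _ => w (z i) t
    rw [this]
    exact Measurable.tsum fun i => measurable_const.indicator (hJm i)
  set u' : X → ℝ := fun x => if x ∈ Ω then u x else v x with hu'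
  set w' : X → ℝ → ℝ≥0∞ := fun x t => D * if x ∈ Ω then w x t else T x t with hw'
  have huΩ : ∀ x ∈ Ω, u' x = u x := fun x hx => if_pos hx
  have huc : ∀ x ∈ collar Ω, u' x = v x := fun x hx => if_neg fun hcon => hdisj x hcon hx
  have hwΩ : ∀ x ∈ Ω, w' x = fun t => D * w x t := fun x hx => by
    funext t; simp only [hw', if_pos hx]
  have hwc : ∀ x ∈ collar Ω, w' x = fun t => D * T x t := fun x hx => by
    funext t; simp only [hw', if_neg fun hcon => hdisj x hcon hx]
  refine ⟨u', w', ⟨Measurable.ite hΩm hu.1 hvm, fun t =>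
    (Measurable.ite hΩm (hu.2 t) (hTm t)).const_mul _, ?_⟩, huΩ, ?_⟩
  · rintro x (hx | hx) y (hy | hy) t ht hxy
    · rw [huΩ x hx, huΩ y hy, hwΩ x hx, hwΩ y hy, ← mul_add]
      refine (hu.edist_le x hx y hy t ht hxy).trans (le_mul_of_one_le_left' ?_)
      exact le_trans (by norm_num) hD113
    · rw [huΩ x hx, huc y hy, hwΩ x hx, hwc y hy, ← mul_add, edist_comm, add_comm]
      exact hmix y hy x hx t ht (by rwa [dist_comm])
    · rw [huc x hx, huΩ y hy, hwc x hx, hwΩ y hy, ← mul_add]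
      exact hmix x hx y hy t ht hxy
    · rw [huc x hx, huc y hy, hwc x hx, hwc y hy, ← mul_add]
      exact hfar x hx y hy t ht hxy
  · refine ne_top_of_le_ne_top ?_ (lintegral_union_le _ _ _)
    refine ENNReal.add_ne_top.2 ⟨?_, ?_⟩
    · have hle : ∀ x ∈ Ω, energy N p u' w' x ≤ ((D : ℝ≥0∞) ^ p + 1) * energy N p u w x := by
        intro x hx
        simp only [energy, huΩ x hx, hwΩ x hx]
        rw [add_mul, one_mul]
        refine add_le_add ?_ le_add_self
        refine (ENNReal.rpow_le_rpow (hN.const_mul_le D (w x)) hp.le).trans ?_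
        rw [ENNReal.mul_rpow_of_nonneg _ _ hp.le]
        gcongr
        exact le_self_add
      refine ne_top_of_le_ne_top ?_ (setLIntegral_mono' hΩm hle)
      have hDp : ((D : ℝ≥0∞) ^ p + 1) ≠ ∞ :=
        ENNReal.add_ne_top.2 ⟨ENNReal.rpow_ne_top_of_nonneg hp.le ENNReal.coe_ne_top, one_ne_top⟩
      rw [lintegral_const_mul' _ _ hDp]
      exact ENNReal.mul_ne_top hDp hfin
    · set M : ℝ≥0∞ := D * ((K + 1) ^ n * n) with hM
      have hMt : M ^ p + 1 ≠ ∞ := by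
        refine ENNReal.add_ne_top.2 ⟨ENNReal.rpow_ne_top_of_nonneg hp.le ?_, one_ne_top⟩
        refine ENNReal.mul_ne_top ENNReal.coe_ne_top (ENNReal.mul_ne_top ?_ (ENNReal.natCast_ne_top n))
        exact ENNReal.pow_ne_top (ENNReal.add_ne_top.2 ⟨ENNReal.coe_ne_top, one_ne_top⟩)
      have hle : ∀ x ∈ collar Ω, energy N p u' w' x ≤ (M ^ p + 1) * B x := by
        intro x hx
        have hB : ∀ i ∈ J x, energy N p u w (z i) ≤ B x := fun i hi => hzB x i ((hJ x i).1 hi).2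
        simp only [energy, huc x hx, hwc x hx]
        rw [add_mul, one_mul]
        refine add_le_add ?_ ?_
        · have h1 : N (fun t => D * T x t) ≤ M * B x ^ p⁻¹ := by
            refine (hN.const_mul_le D (T x)).trans ?_
            rw [hM, mul_assoc, mul_assoc]
            refine mul_le_mul_right ((hN.sum_le (J x) fun i => w (z i)).trans ?_) _
            refine mul_le_mul' (pow_le_pow_right₀ le_add_self (hn x)) ?_
            calc ∑ i ∈ J x, N (w (z i)) ≤ ∑ i ∈ J x, B x ^ p⁻¹ :=
                  Finset.sum_le_sum fun i hi =>
                    (ENNReal.le_rpow_inv_iff hp).2 (le_self_add.trans (hB i hi))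
              _ = (J x).card * B x ^ p⁻¹ := by rw [Finset.sum_const, nsmul_eq_mul]
              _ ≤ n * B x ^ p⁻¹ := by
                  gcongr
                  exact hn x
          refine (ENNReal.rpow_le_rpow h1 hp.le).trans ?_
          rw [ENNReal.mul_rpow_of_nonneg _ _ hp.le, ENNReal.rpow_inv_rpow hp.ne']
        · rw [← ENNReal.le_rpow_inv_iff hp, ← edist_zero_right]
          refine edist_sum_mul_le (fun i _ => ha0 i x) (ha1 x hx) fun i hi => ?_
          rw [edist_zero_right, ENNReal.le_rpow_inv_iff hp]
          exact le_add_self.trans (hB i hi)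
      refine ne_top_of_le_ne_top ?_ (setLIntegral_mono' hcm hle)
      rw [lintegral_const_mul' _ _ hMt]
      exact ENNReal.mul_ne_top hMt hBfin

end

lemma add_rpow_le_two_rpow_mul (a b : ℝ≥0∞) {p : ℝ} (hp : 0 < p) :
    (a + b) ^ p ≤ 2 ^ p * (a ^ p + b ^ p) := by
  wlog hab : a ≤ b generalizing a b
  · rw [add_comm a, add_comm (a ^ p)]
    exact this b a (le_of_not_ge hab)
  calc (a + b) ^ p ≤ (2 * b) ^ p := by
        gcongr
        rw [two_mul]
        gcongr
    _ = 2 ^ p * b ^ p := ENNReal.mul_rpow_of_nonneg _ _ hp.le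
    _ ≤ _ := by gcongr; exact le_add_self

lemma edist_mul_le {a b x y t : ℝ} (ha : |a| ≤ 1) (hab : |a - b| ≤ t) :
    edist (a * x) (b * y) ≤ edist x y + ENNReal.ofReal t * ‖y‖ₑ := by
  have ht : 0 ≤ t := (abs_nonneg _).trans hab
  rw [edist_dist, edist_dist, ← ofReal_norm, ← ENNReal.ofReal_mul ht,
    ← ENNReal.ofReal_add dist_nonneg (by positivity)]
  refine ENNReal.ofReal_le_ofReal ?_
  rw [Real.dist_eq, Real.dist_eq, Real.norm_eq_abs]
  calc |a * x - b * y| = |a * (x - y) + (a - b) * y| := by ring_nf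
    _ ≤ |a| * |x - y| + |a - b| * |y| := by
        rw [← abs_mul, ← abs_mul]
        exact abs_add_le _ _
    _ ≤ 1 * |x - y| + t * |y| := by gcongr
    _ = _ := by rw [one_mul]

section

variable {X : Type*} [PseudoMetricSpace X] [MeasurableSpace X] [OpensMeasurableSpace X]
  [SecondCountableTopology X] {μ : Measure X} [SigmaFinite μ] {Ω : Set X}

lemma HasModulus.exists_extension (h : DoublingDomain μ Ω) (hΩ : Ω.Nonempty)
    {N : (ℝ → ℝ≥0∞) → ℝ≥0∞} {K : NNReal} (hN : IsCost N K) {p : ℝ} (hp : 0 < p)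
    {u : X → ℝ} {w : X → ℝ → ℝ≥0∞} (hu : HasModulus Ω u w) (hw : IsRegularModulus w)
    (hfin : ∫⁻ x in Ω, energy N p u w x ∂μ ≠ ∞) :
    ∃ (T : Set X) (v : X → ℝ) (W : X → ℝ → ℝ≥0∞), μ Tᶜ = 0 ∧ HasModulus T v W ∧
      (∀ x ∈ Ω, v x = u x) ∧ ∫⁻ x, energy N p v W x ∂μ ≠ ∞ := by
  classical
  obtain ⟨u₁, w₁, hu₁, hu₁u, hfin₁⟩ := hu.exists_extension_collar h hΩ hN hp hw hfin
  obtain ⟨S, u', w', hS, hsub, hnull, hu', hu'u, hfin'⟩ := hu₁.exists_extension_closure h hN hp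
    (h.measurableSet.union (isOpen_collar Ω).measurableSet) subset_union_left hfin₁
  set ψ : X → ℝ := fun x => max 0 (1 - infDist x Ω) with hψ
  have hψ0 : ∀ x, 0 ≤ ψ x := fun x => le_max_left _ _
  have hψ1 : ∀ x, |ψ x| ≤ 1 := fun x => by
    rw [abs_of_nonneg (hψ0 x)]
    exact max_le zero_le_one (by linarith [infDist_nonneg (x := x) (s := Ω)])
  have hψm : Measurable ψ :=
    measurable_const.max (measurable_const.sub (continuous_infDist_pt Ω).measurable)
  have hψd : ∀ x y, |ψ x - ψ y| ≤ dist x y := fun x y => by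
    refine (abs_max_sub_max_le_max _ _ _ _).trans (max_le (by simp) ?_)
    have h1 := infDist_le_infDist_add_dist (x := x) (y := y) (s := Ω)
    have h2 := infDist_le_infDist_add_dist (x := y) (y := x) (s := Ω)
    rw [dist_comm y x] at h2
    rw [abs_le]
    constructor <;> linarith
  have hψz : ∀ y, 1 ≤ infDist y Ω → ψ y = 0 := fun y hy => max_eq_left (by linarith)
  set v : X → ℝ := fun x => if x ∈ S then ψ x * u' x else 0 with hv
  set W : X → ℝ → ℝ≥0∞ := fun x t =>
    if x ∈ S then w' x t + ENNReal.ofReal t * ‖u' x‖ₑ else 0 with hW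
  have hvS : ∀ x ∈ S, v x = ψ x * u' x := fun x hx => if_pos hx
  have hvc : ∀ x, x ∉ S → v x = 0 := fun x hx => if_neg hx
  have hWS : ∀ x ∈ S, W x = fun t => w' x t + ENNReal.ofReal t * ‖u' x‖ₑ := fun x hx => by
    funext t; exact if_pos hx
  have hWc : ∀ x, x ∉ S → W x = fun _ => 0 := fun x hx => by
    funext t; exact if_neg hx
  have hmix : ∀ x ∈ S, ∀ y, y ∉ S → 1 ≤ infDist y Ω → ∀ t, dist x y < t →
      edist (v x) (v y) ≤ W x t + W y t := by
    intro x hx y hy hyδ t hxy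
    rw [hvS x hx, hvc y hy, hWS x hx, hWc y hy, add_zero]
    have h1 : |ψ x| ≤ t := by
      have := hψd x y
      rw [hψz y hyδ, sub_zero] at this
      exact this.trans hxy.le
    have := edist_mul_le (a := 0) (b := ψ x) (x := u' x) (y := u' x) (t := t) (by simp) (by simpa)
    rw [zero_mul, edist_self, zero_add] at this
    rw [edist_comm]
    exact this.trans le_add_self
  refine ⟨S ∪ {x | 1 ≤ infDist x Ω}, v, W, ?_, ⟨?_, fun t => ?_, ?_⟩, ?_, ?_⟩
  · refine measure_mono_null (fun x hx => ?_) hnull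
    simp only [mem_compl_iff, mem_union, not_or, mem_ofPred_eq, not_le] at hx
    refine ⟨?_, hx.1⟩
    rw [mem_closure_iff_infDist_zero hΩ]
    by_contra hne
    exact hx.1 (hsub (Or.inr ⟨lt_of_le_of_ne infDist_nonneg (Ne.symm hne), hx.2⟩))
  · exact Measurable.ite hS (hψm.mul hu'.1) measurable_const
  · exact Measurable.ite hS ((hu'.2 t).add (hu'.1.enorm.const_mul _)) measurable_const
  · intro x hx y hy t ht hxy
    by_cases hxS : x ∈ S <;> by_cases hyS : y ∈ S
    · rw [hvS x hxS, hvS y hyS, hWS x hxS, hWS y hyS]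
      refine (edist_mul_le (hψ1 x) ((hψd x y).trans hxy.le)).trans ?_
      calc edist (u' x) (u' y) + ENNReal.ofReal t * ‖u' y‖ₑ
          ≤ w' x t + w' y t + ENNReal.ofReal t * ‖u' y‖ₑ := by
            gcongr
            exact hu'.edist_le x hxS y hyS t ht hxy
        _ ≤ w' x t + ENNReal.ofReal t * ‖u' x‖ₑ + (w' y t + ENNReal.ofReal t * ‖u' y‖ₑ) := by
            rw [add_assoc]
            gcongr
            exact le_self_add
    · exact hmix x hxS y hyS (hy.resolve_left hyS) t hxy
    · rw [edist_comm, add_comm]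
      exact hmix y hyS x hxS (hx.resolve_left hxS) t (by rwa [dist_comm])
    · rw [hvc x hxS, hvc y hyS, edist_self]
      exact zero_le
  · intro x hx
    rw [hvS x (hsub (Or.inl hx)), hu'u x (Or.inl hx), hu₁u x hx]
    have : ψ x = 1 := by
      simp only [hψ, infDist_zero_of_mem hx, sub_zero]
      exact max_eq_right zero_le_one
    rw [this, one_mul]
  · set M : ℝ≥0∞ := (K : ℝ≥0∞) ^ p * (2 ^ p * (1 + (K : ℝ≥0∞) ^ p)) + 1 with hM
    have hKp : (K : ℝ≥0∞) ^ p ≠ ∞ := ENNReal.rpow_ne_top_of_nonneg hp.le ENNReal.coe_ne_top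
    have hMt : M ≠ ∞ := by
      refine ENNReal.add_ne_top.2 ⟨ENNReal.mul_ne_top hKp (ENNReal.mul_ne_top ?_ ?_), one_ne_top⟩
      · exact ENNReal.rpow_ne_top_of_nonneg hp.le ofNat_ne_top
      · exact ENNReal.add_ne_top.2 ⟨one_ne_top, hKp⟩
    have hle : ∀ x, energy N p v W x ≤ S.indicator (fun x => M * energy N p u' w' x) x := by
      intro x
      by_cases hx : x ∈ S
      · rw [indicator_of_mem hx]
        simp only [energy, hvS x hx, hWS x hx]
        have h1 : N (fun t => w' x t + ENNReal.ofReal t * ‖u' x‖ₑ) ≤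
            K * (N (w' x) + K * ‖u' x‖ₑ) :=
          (hN.add_le _ _).trans (by gcongr; exact hN.linear_le ‖u' x‖₊)
        have h2 : ‖ψ x * u' x‖ₑ ≤ ‖u' x‖ₑ := by
          rw [enorm_mul]
          refine mul_le_of_le_one_left' ?_
          rw [← ofReal_norm, Real.norm_eq_abs]
          exact ENNReal.ofReal_le_one.2 (hψ1 x)
        set A := N (w' x)
        set B := ‖u' x‖ₑ
        calc N (fun t => w' x t + ENNReal.ofReal t * B) ^ p + ‖ψ x * u' x‖ₑ ^ p
            ≤ (K * (A + K * B)) ^ p + B ^ p := by gcongr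
          _ ≤ (K : ℝ≥0∞) ^ p * (2 ^ p * (A ^ p + (K : ℝ≥0∞) ^ p * B ^ p)) + B ^ p := by
              rw [ENNReal.mul_rpow_of_nonneg _ _ hp.le, ← ENNReal.mul_rpow_of_nonneg _ B hp.le]
              gcongr
              exact add_rpow_le_two_rpow_mul _ _ hp
          _ ≤ (K : ℝ≥0∞) ^ p * (2 ^ p * ((1 + (K : ℝ≥0∞) ^ p) * (A ^ p + B ^ p))) +
                1 * (A ^ p + B ^ p) := by
              rw [one_mul, add_mul, one_mul]
              gcongr
              · exact le_self_add
              · exact le_add_self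
              · exact le_add_self
          _ = M * (A ^ p + B ^ p) := by rw [hM]; ring
      · rw [indicator_of_notMem hx]
        have h0 : N (fun _ => 0) = 0 := by
          have := hN.const_mul_le 0 (fun _ => 0)
          simpa using this
        simp only [energy, hvc x hx, hWc x hx, h0, enorm_zero, ENNReal.zero_rpow_of_pos hp, add_zero,
          le_refl]
    refine ne_top_of_le_ne_top ?_ (lintegral_mono hle)
    rw [lintegral_indicator hS, lintegral_const_mul' _ _ hMt]
    exact ENNReal.mul_ne_top hMt hfin'

end

lemma lqN_top (a : ℤ → ℝ≥0∞) : lqN ∞ a = ⨆ k, a k := if_pos rfl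

lemma lqN_of_ne_top {q : ℝ≥0∞} (hq : q ≠ ∞) (a : ℤ → ℝ≥0∞) :
    lqN q a = (∑' k, a k ^ q.toReal) ^ (1 / q.toReal) := if_neg hq

lemma lqN_mono (q : ℝ≥0∞) {a b : ℤ → ℝ≥0∞} (h : ∀ k, a k ≤ b k) : lqN q a ≤ lqN q b := by
  by_cases hq : q = ∞
  · subst hq
    rw [lqN_top, lqN_top]
    exact iSup_mono h
  · rw [lqN_of_ne_top hq, lqN_of_ne_top hq]
    exact ENNReal.rpow_le_rpow (ENNReal.tsum_le_tsum fun k =>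
      ENNReal.rpow_le_rpow (h k) ENNReal.toReal_nonneg) (by positivity)

lemma lqN_const_mul {q : ℝ≥0∞} (hq0 : q ≠ 0) (c : ℝ≥0∞) (a : ℤ → ℝ≥0∞) :
    lqN q (fun k => c * a k) = c * lqN q a := by
  by_cases hq : q = ∞
  · subst hq
    rw [lqN_top, lqN_top, ENNReal.mul_iSup]
  · have hr : 0 < q.toReal := ENNReal.toReal_pos hq0 hq
    rw [lqN_of_ne_top hq, lqN_of_ne_top hq]
    simp only [ENNReal.mul_rpow_of_nonneg _ _ hr.le]
    rw [ENNReal.tsum_mul_left, ENNReal.mul_rpow_of_nonneg _ _ (by positivity), ← ENNReal.rpow_mul,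
      mul_one_div_cancel hr.ne', ENNReal.rpow_one]

lemma le_lqN {q : ℝ≥0∞} (hq0 : q ≠ 0) (a : ℤ → ℝ≥0∞) (k : ℤ) : a k ≤ lqN q a := by
  by_cases hq : q = ∞
  · subst hq
    rw [lqN_top]
    exact le_iSup a k
  · have hr : 0 < q.toReal := ENNReal.toReal_pos hq0 hq
    rw [lqN_of_ne_top hq, one_div, ENNReal.le_rpow_inv_iff hr]
    exact ENNReal.le_tsum (f := fun k => a k ^ q.toReal) k

lemma exists_lqN_add_le {q : ℝ≥0∞} (hq0 : q ≠ 0) :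
    ∃ K : NNReal, ∀ a b : ℤ → ℝ≥0∞, lqN q (fun k => a k + b k) ≤ K * (lqN q a + lqN q b) := by
  by_cases hq : q = ∞
  · subst hq
    refine ⟨1, fun a b => ?_⟩
    rw [lqN_top, lqN_top, lqN_top, ENNReal.coe_one, one_mul]
    exact iSup_add_le a b
  · have hr : 0 < q.toReal := ENNReal.toReal_pos hq0 hq
    have hr' : 0 < 1 / q.toReal := by positivity
    have hM : (2 : ℝ≥0∞) * 2 ^ (1 / q.toReal) ≠ ∞ :=
      ENNReal.mul_ne_top ofNat_ne_top (ENNReal.rpow_ne_top_of_nonneg hr'.le ofNat_ne_top)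
    refine ⟨(2 * 2 ^ (1 / q.toReal) : ℝ≥0∞).toNNReal, fun a b => ?_⟩
    rw [ENNReal.coe_toNNReal hM, lqN_of_ne_top hq, lqN_of_ne_top hq, lqN_of_ne_top hq]
    calc (∑' k, (a k + b k) ^ q.toReal) ^ (1 / q.toReal)
        ≤ (∑' k, 2 ^ q.toReal * (a k ^ q.toReal + b k ^ q.toReal)) ^ (1 / q.toReal) := by
          gcongr
          exact add_rpow_le_two_rpow_mul _ _ hr
      _ = 2 * (∑' k, a k ^ q.toReal + ∑' k, b k ^ q.toReal) ^ (1 / q.toReal) := by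
          rw [ENNReal.tsum_mul_left, ENNReal.tsum_add, ENNReal.mul_rpow_of_nonneg _ _ hr'.le,
            ← ENNReal.rpow_mul, mul_one_div_cancel hr.ne', ENNReal.rpow_one]
      _ ≤ _ := by
          rw [mul_assoc]
          gcongr
          exact add_rpow_le_two_rpow_mul _ _ hr'

lemma liminf_rpow {r : ℝ} (hr : 0 < r) (a : ℕ → ℝ≥0∞) :
    (liminf a atTop) ^ r = liminf (fun m => a m ^ r) atTop :=
  OrderIso.liminf_apply (ENNReal.orderIsoRpow r hr)

lemma lqN_liminf_le {q : ℝ≥0∞} (hq0 : q ≠ 0) (a : ℕ → ℤ → ℝ≥0∞) :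
    lqN q (fun k => liminf (fun m => a m k) atTop) ≤ liminf (fun m => lqN q (a m)) atTop := by
  by_cases hq : q = ∞
  · subst hq
    simp only [lqN_top]
    exact iSup_le fun k => liminf_le_liminf (Eventually.of_forall fun m => le_iSup (a m) k)
  · have hr : 0 < q.toReal := ENNReal.toReal_pos hq0 hq
    simp only [lqN_of_ne_top hq, liminf_rpow hr]
    rw [← liminf_rpow (by positivity)]
    gcongr
    simp only [← lintegral_count]
    exact lintegral_liminf_le fun m => measurable_of_countable _

lemma measurable_lqN (q : ℝ≥0∞) : Measurable (lqN q) := by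
  by_cases hq : q = ∞
  · subst hq
    have : lqN ∞ = fun a : ℤ → ℝ≥0∞ => ⨆ k, a k := funext lqN_top
    rw [this]
    exact Measurable.iSup fun k => measurable_pi_apply k
  · have : lqN q = fun a : ℤ → ℝ≥0∞ => (∑' k, a k ^ q.toReal) ^ (1 / q.toReal) :=
      funext (lqN_of_ne_top hq)
    rw [this]
    exact (Measurable.tsum fun k => (measurable_pi_apply k).pow_const _).pow_const _

lemma tsum_two_rpow_neg_abs_ne_top {ε : ℝ} (hε : 0 < ε) :
    ∑' n : ℤ, ENNReal.ofReal (2 ^ (-ε * |(n : ℝ)|)) ≠ ∞ := by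
  refine Summable.tsum_ofReal_ne_top ?_
  have h : Summable fun n : ℕ => (2 : ℝ) ^ (-ε * (n : ℝ)) := by
    have : (fun n : ℕ => (2 : ℝ) ^ (-ε * (n : ℝ))) = fun n : ℕ => ((2 : ℝ) ^ (-ε)) ^ n := by
      funext n
      rw [Real.rpow_mul zero_le_two, Real.rpow_natCast]
    rw [this]
    exact summable_geometric_of_lt_one (by positivity)
      (Real.rpow_lt_one_of_one_lt_of_neg one_lt_two (by linarith))
  refine Summable.of_nat_of_neg ?_ ?_
  · simpa using h
  · simpa using h

lemma lqN_two_rpow_neg_abs_ne_top {ε : ℝ} {q : ℝ≥0∞} (hq0 : q ≠ 0) (hε : 0 ≤ ε)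
    (hεq : q ≠ ∞ → 0 < ε) : lqN q (fun k => ENNReal.ofReal (2 ^ (-ε * |(k : ℝ)|))) ≠ ∞ := by
  by_cases hq : q = ∞
  · subst hq
    rw [lqN_top]
    refine ne_top_of_le_ne_top one_ne_top (iSup_le fun k => ENNReal.ofReal_le_one.2 ?_)
    exact Real.rpow_le_one_of_one_le_of_nonpos one_le_two
      (mul_nonpos_of_nonpos_of_nonneg (by linarith) (abs_nonneg _))
  · have hr : 0 < q.toReal := ENNReal.toReal_pos hq0 hq
    rw [lqN_of_ne_top hq]
    refine ENNReal.rpow_ne_top_of_nonneg (by positivity) ?_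
    have := tsum_two_rpow_neg_abs_ne_top (mul_pos (hεq hq) hr)
    convert this using 3 with k
    rw [ENNReal.ofReal_rpow_of_pos (by positivity), ← Real.rpow_mul zero_le_two]
    ring_nf

/-- The weight `2 ^ (s k)` at nonnegative scales `k`, and `0` at negative ones. -/
def scaleWeight (s : ℝ) (k : ℤ) : ℝ≥0∞ := if 0 ≤ k then ENNReal.ofReal (2 ^ (s * k)) else 0

lemma scaleWeight_ne_top (s : ℝ) (k : ℤ) : scaleWeight s k ≠ ∞ := by
  unfold scaleWeight
  split_ifs
  · exact ENNReal.ofReal_ne_top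
  · exact ENNReal.zero_ne_top

/-- The `ℓ^q` size of a modulus of continuity at the scales `2 ^ (-β k)`, `0 ≤ k`, measured
relatively to `2 ^ (-s k)`. -/
def modulusCost (s β : ℝ) (q : ℝ≥0∞) (w : ℝ → ℝ≥0∞) : ℝ≥0∞ :=
  lqN q fun k => scaleWeight s k * w (2 ^ (-β * k))

lemma lqN_scaleWeight_ne_top {s β : ℝ} {q : ℝ≥0∞} (hq0 : q ≠ 0) (hβ : s ≤ β)
    (hβq : q ≠ ∞ → s < β) :
    lqN q (fun k => scaleWeight s k * ENNReal.ofReal (2 ^ (-β * k))) ≠ ∞ := by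
  have hle : ∀ k : ℤ, scaleWeight s k * ENNReal.ofReal (2 ^ (-β * k)) ≤
      ENNReal.ofReal (2 ^ (-(β - s) * |(k : ℝ)|)) := by
    intro k
    unfold scaleWeight
    split_ifs with hk
    · have hk' : (0 : ℝ) ≤ k := by exact_mod_cast hk
      rw [← ENNReal.ofReal_mul (by positivity), ← Real.rpow_add two_pos, abs_of_nonneg hk']
      exact le_of_eq (by ring_nf)
    · rw [zero_mul]
      exact zero_le
  refine ne_top_of_le_ne_top ?_ (lqN_mono q hle)
  exact lqN_two_rpow_neg_abs_ne_top hq0 (sub_nonneg.2 hβ) fun hq => sub_pos.2 (hβq hq)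

lemma exists_isCost_modulusCost {s β : ℝ} {q : ℝ≥0∞} (hs : 0 < s) (hq0 : q ≠ 0) (hβ : s ≤ β)
    (hβq : q ≠ ∞ → s < β) : ∃ K : NNReal, IsCost (modulusCost s β q) K := by
  obtain ⟨K, hK⟩ := exists_lqN_add_le hq0
  set L := lqN q (fun k => scaleWeight s k * ENNReal.ofReal (2 ^ (-β * k))) with hL
  have hLt : L ≠ ∞ := lqN_scaleWeight_ne_top hq0 hβ hβq
  have hpos : ∀ k : ℤ, (0 : ℝ) < 2 ^ (-β * k) := fun k => by positivity
  refine ⟨K + L.toNNReal, ⟨fun w w' => ?_, fun c w => ?_, fun a => ?_,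
    fun w => ?_, ?_, fun ε hε => ?_⟩⟩
  · unfold modulusCost
    simp only [mul_add]
    rw [← mul_add]
    refine (hK _ _).trans ?_
    gcongr
    exact le_self_add
  · unfold modulusCost
    simp only [mul_left_comm _ (c : ℝ≥0∞)]
    exact (lqN_const_mul hq0 _ _).le
  · unfold modulusCost
    simp only [← mul_assoc, mul_comm _ (a : ℝ≥0∞)]
    simp only [mul_assoc]
    rw [lqN_const_mul hq0, ← hL]
    gcongr
    rw [ENNReal.coe_add, ENNReal.coe_toNNReal hLt]
    exact le_add_self
  · refine le_trans (lqN_mono q fun k => ?_) (lqN_liminf_le hq0 _)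
    rw [ENNReal.liminf_const_mul_of_ne_top (scaleWeight_ne_top s k)]
  · exact (measurable_lqN q).comp
      (measurable_pi_lambda _ fun k => (measurable_pi_apply _).const_mul _)
  · obtain ⟨n, hn⟩ := exists_pow_lt_of_lt_one (y := (2 : ℝ) ^ (-s)) (NNReal.coe_pos.2 hε)
      (Real.rpow_lt_one_of_one_lt_of_neg one_lt_two (by linarith))
    rw [← Real.rpow_natCast, ← Real.rpow_mul zero_le_two] at hn
    refine ⟨2 ^ (-β * (n : ℤ)), hpos n, fun w => ?_⟩
    have h1 := le_lqN hq0 (fun k => scaleWeight s k * w (2 ^ (-β * k))) n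
    have h2 : ENNReal.ofReal (2 ^ (-s * (n : ℝ))) * scaleWeight s n = 1 := by
      rw [scaleWeight, if_pos (Int.natCast_nonneg n), ← ENNReal.ofReal_mul (by positivity),
        ← Real.rpow_add two_pos, Int.cast_natCast]
      simp
    calc w (2 ^ (-β * (n : ℤ)))
        = ENNReal.ofReal (2 ^ (-s * (n : ℝ))) * (scaleWeight s n * w (2 ^ (-β * (n : ℤ)))) := by
          rw [← mul_assoc, h2, one_mul]
      _ ≤ ε * modulusCost s β q w := by
          gcongr
          · rw [← ENNReal.ofReal_coe_nnreal]
            exact ENNReal.ofReal_le_ofReal hn.le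
          · exact h1

lemma IsQMMS.sigmaFinite {X : Type*} [MeasurableSpace X] {ρ : X → X → ℝ} {μ : Measure X}
    (hX : IsQMMS ρ μ) : SigmaFinite μ := by
  obtain ⟨x, -⟩ := hX.nontrivial
  have hp : ∀ n : ℕ, (0 : ℝ) < n + 1 := fun n => by positivity
  refine ⟨⟨⟨fun n : ℕ => qball ρ x (n + 1), fun n => trivial, fun n => hX.ball_lt_top x _ (hp n), ?_⟩⟩⟩
  refine eq_univ_of_forall fun y => ?_
  obtain ⟨n, hn⟩ := exists_nat_gt (ρ x y)
  exact mem_iUnion.2 ⟨n, hn.trans (lt_add_one _)⟩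

section

variable {X : Type*} [PseudoMetricSpace X] {ρ : X → X → ℝ} {β c : ℝ}

lemma qball_subset_ball (hρ : IsQuasiDist ρ) (hβ : 0 < β) (hc : 1 ≤ c)
    (hd : ∀ x y, dist x y ≤ c * ρ x y ^ β ∧ ρ x y ^ β ≤ c * dist x y) (x : X) {t : ℝ}
    (ht : 0 < t) : qball ρ x ((t / c) ^ β⁻¹) ⊆ ball x t := by
  intro y hy
  have hc0 : 0 < c := by linarith
  have h1 : ρ x y ^ β < t / c := by
    have := Real.rpow_lt_rpow (hρ.1 x y) hy hβ
    rwa [Real.rpow_inv_rpow (by positivity) hβ.ne'] at this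
  rw [mem_ball']
  refine (hd x y).1.trans_lt ?_
  rwa [lt_div_iff₀' hc0] at h1

lemma ball_subset_qball (hρ : IsQuasiDist ρ) (hβ : 0 < β) (hc : 1 ≤ c)
    (hd : ∀ x y, dist x y ≤ c * ρ x y ^ β ∧ ρ x y ^ β ≤ c * dist x y) (x : X) {t : ℝ}
    (ht : 0 < t) : ball x t ⊆ qball ρ x ((c * t) ^ β⁻¹) := by
  intro y hy
  have hc0 : 0 < c := by linarith
  rw [mem_ball'] at hy
  refine (Real.lt_rpow_inv_iff_of_pos (hρ.1 x y) (by positivity) hβ).2 ?_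
  exact (hd x y).2.trans_lt (by gcongr)

variable [MeasurableSpace X] {μ : Measure X}

lemma IsQMMS.secondCountableTopology (hX : IsQMMS ρ μ) (hβ : 0 < β) (hc : 1 ≤ c)
    (hd : ∀ x y, dist x y ≤ c * ρ x y ^ β ∧ ρ x y ^ β ≤ c * dist x y) :
    SecondCountableTopology X := by
  have := hX.sigmaFinite
  refine Metric.secondCountable_of_almost_dense_set fun ε hε => ?_
  have hε2 : 0 < ε / 2 := by positivity
  obtain ⟨u, -, hdisj, hcov⟩ := Vitali.exists_disjoint_subfamily_covering_enlargement
    (fun x : X => ball x (ε / 2)) univ (fun _ => ε / 2) 2 one_lt_two (fun _ _ => hε2.le) (ε / 2)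
    (fun _ _ => le_rfl) (fun x _ => ⟨x, mem_ball_self hε2⟩)
  have hr : 0 < (ε / 2 / c) ^ β⁻¹ := by positivity
  have hsub := fun x => qball_subset_ball hX.quasi hβ hc hd x hε2
  have hcount := Measure.countable_meas_pos_of_disjoint_iUnion (μ := μ)
    (As := fun x : u => qball ρ (x : X) ((ε / 2 / c) ^ β⁻¹))
    (fun x => hX.measurableSet_ball x _ hr) fun x y hxy =>
      (hdisj x.2 y.2 (fun h => hxy (Subtype.ext h))).mono (hsub x) (hsub y)
  refine ⟨u, ?_, fun x => ?_⟩
  · have h1 : {x : u | 0 < μ (qball ρ (x : X) ((ε / 2 / c) ^ β⁻¹))} = univ :=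
      eq_univ_of_forall fun x => hX.ball_pos x _ hr
    rw [h1, countable_univ_iff] at hcount
    exact countable_coe_iff.1 hcount
  · obtain ⟨y, hy, ⟨z, hzx, hzy⟩, -⟩ := hcov x (mem_univ x)
    refine ⟨y, hy, ?_⟩
    rw [mem_ball] at hzx hzy
    linarith [dist_triangle_left x y z]

lemma IsQMMS.opensMeasurableSpace (hX : IsQMMS ρ μ) (hβ : 0 < β) (hc : 1 ≤ c)
    (hd : ∀ x y, dist x y ≤ c * ρ x y ^ β ∧ ρ x y ^ β ≤ c * dist x y) :
    OpensMeasurableSpace X := by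
  have := hX.secondCountableTopology hβ hc hd
  have hc0 : 0 < c := by linarith
  refine ⟨MeasurableSpace.generateFrom_le fun U hU => ?_⟩
  obtain ⟨D, hD, hDd⟩ := TopologicalSpace.exists_countable_dense X
  have hpos : ∀ n : ℕ, (0 : ℝ) < (1 / ((n : ℝ) + 1) / c) ^ β⁻¹ := fun n => by positivity
  have hU' : U = ⋃ y ∈ D, ⋃ n : ℕ, ⋃ _ : ball y (1 / ((n : ℝ) + 1)) ⊆ U,
      qball ρ y ((1 / ((n : ℝ) + 1) / c) ^ β⁻¹) := by
    refine Subset.antisymm (fun x hx => ?_) ?_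
    · obtain ⟨ε, hε, hεU⟩ := Metric.isOpen_iff.1 hU x hx
      obtain ⟨n, hn⟩ := exists_nat_one_div_lt (half_pos hε)
      have hn0 : (0 : ℝ) < 1 / ((n : ℝ) + 1) := by positivity
      obtain ⟨y, hyD, hxy⟩ := hDd.exists_dist_lt x
        (show 0 < min (ε / 2) (1 / ((n : ℝ) + 1) / c / c) by positivity)
      simp only [mem_iUnion]
      refine ⟨y, hyD, n, fun z hz => hεU ?_, ?_⟩
      · rw [mem_ball] at hz ⊢
        have := dist_triangle_right z x y
        linarith [hxy.trans_le (min_le_left _ _)]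
      · have h1 := ball_subset_qball hX.quasi hβ hc hd y
          (show 0 < 1 / ((n : ℝ) + 1) / c / c by positivity)
        rw [mul_div_cancel₀ _ hc0.ne'] at h1
        exact h1 (hxy.trans_le (min_le_right _ _))
    · refine iUnion₂_subset fun y _ => iUnion₂_subset fun n hn => ?_
      exact (qball_subset_ball hX.quasi hβ hc hd y (by positivity)).trans hn
  rw [hU']
  exact MeasurableSet.biUnion hD fun y _ => MeasurableSet.iUnion fun n =>
    MeasurableSet.iUnion fun _ => hX.measurableSet_ball y _ (hpos n)

lemma IsQMMS.exists_measure_ball_le (hX : IsQMMS ρ μ) {Q : ℝ} (hQ : QDoubling ρ μ Q)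
    (hβ : 0 < β) (hc : 1 ≤ c)
    (hd : ∀ x y, dist x y ≤ c * ρ x y ^ β ∧ ρ x y ^ β ≤ c * dist x y) (K : ℝ) :
    ∃ C : NNReal, ∀ (x : X) (r : ℝ), 0 < r →
      μ (ball x (K * r)) ≤ C * μ (qball ρ x ((r / c) ^ β⁻¹)) := by
  obtain ⟨κ, hκ, h⟩ := hQ
  have hc0 : 0 < c := by linarith
  set M := max K 1 with hM
  have hM0 : 0 < M := lt_of_lt_of_le one_pos (le_max_right _ _)
  set A : ℝ := κ * ((1 / (c * M * c)) ^ β⁻¹) ^ Q with hA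
  have hA0 : 0 < A := by positivity
  refine ⟨(A.toNNReal)⁻¹, fun x r hr => ?_⟩
  have hle : (r / c) ^ β⁻¹ ≤ (c * (M * r)) ^ β⁻¹ := by
    have : r / c ≤ c * (M * r) := by
      rw [div_le_iff₀ hc0]
      have h1 : 1 ≤ c * M := one_le_mul_of_one_le_of_one_le hc (le_max_right _ _)
      have h2 : 1 ≤ c * M * c := one_le_mul_of_one_le_of_one_le h1 hc
      nlinarith
    gcongr
  have h1 := h x x ((r / c) ^ β⁻¹) ((c * (M * r)) ^ β⁻¹) (by positivity) hle
    fun y hy => lt_of_lt_of_le hy hle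
  have h2 : κ * ((r / c) ^ β⁻¹ / (c * (M * r)) ^ β⁻¹) ^ Q = A := by
    rw [hA, ← Real.div_rpow (by positivity) (by positivity)]
    congr 3
    field_simp
  rw [h2] at h1
  calc μ (ball x (K * r)) ≤ μ (ball x (M * r)) :=
        measure_mono (ball_subset_ball (by gcongr; exact le_max_left _ _))
    _ ≤ μ (qball ρ x ((c * (M * r)) ^ β⁻¹)) :=
        measure_mono (ball_subset_qball hX.quasi hβ hc hd x (by positivity))
    _ ≤ _ := by
        rw [ENNReal.coe_inv (Real.toNNReal_pos.2 hA0).ne', ← ENNReal.div_eq_inv_mul,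
          ENNReal.le_div_iff_mul_le (Or.inl (by simpa using hA0)) (Or.inl ENNReal.coe_ne_top),
          mul_comm]
        exact h1

lemma IsQMMS.doublingDomain (hX : IsQMMS ρ μ) {Q : ℝ} (hQ : QDoubling ρ μ Q)
    (hβ : 0 < β) (hc : 1 ≤ c)
    (hd : ∀ x y, dist x y ≤ c * ρ x y ^ β ∧ ρ x y ^ β ≤ c * dist x y) {Ω : Set X}
    (hΩ : MeasurableSet Ω) (hdens : MeasDensity ρ μ Ω) : DoublingDomain μ Ω := by
  have hc0 : 0 < c := by linarith
  have hsub := fun x r hr => qball_subset_ball (t := r) hX.quasi hβ hc hd x hr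
  refine ⟨fun x r hr => ?_, fun x r => ?_, fun K => ?_, hΩ, ?_⟩
  · exact (hX.ball_pos x _ (by positivity)).trans_le (measure_mono (hsub x r hr))
  · rcases le_or_gt r 0 with hr | hr
    · rw [ball_eq_empty.2 hr, measure_empty]
      exact zero_lt_top
    · exact (measure_mono (ball_subset_qball hX.quasi hβ hc hd x hr)).trans_lt
        (hX.ball_lt_top x _ (by positivity))
  · obtain ⟨C, hC⟩ := hX.exists_measure_ball_le hQ hβ hc hd K
    exact ⟨C, fun x r hr => (hC x r hr).trans (by gcongr; exact hsub x r hr)⟩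
  · obtain ⟨C, hC⟩ := hX.exists_measure_ball_le hQ hβ hc hd 1
    obtain ⟨b, hb, hdens⟩ := hdens
    refine ⟨C * b.toNNReal, fun x hx r hr hr1 => ?_⟩
    have h1 := hC x r hr
    rw [one_mul] at h1
    have h2 : (r / c) ^ β⁻¹ ≤ 1 := Real.rpow_le_one (by positivity)
      (by rw [div_le_one hc0]; linarith) (by positivity)
    rw [ENNReal.coe_mul, mul_assoc]
    refine h1.trans ?_
    gcongr
    refine (hdens x hx _ (by positivity) h2).trans ?_
    gcongr
    · exact le_rfl
    · exact hsub x r hr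

lemma DoublingDomain.sdiff_null {Ω Z : Set X} (h : DoublingDomain μ Ω) (hZ : MeasurableSet Z)
    (hZ0 : μ Z = 0) : DoublingDomain μ (Ω \ Z) := by
  refine ⟨h.ball_pos, h.ball_lt_top, h.doubling, h.measurableSet.diff hZ, ?_⟩
  obtain ⟨C, hC⟩ := h.density
  refine ⟨C, fun x hx r hr hr1 => (hC x hx.1 r hr hr1).trans ?_⟩
  rw [← inter_sdiff_assoc, measure_sdiff_null hZ0]

end

lemma lqN_comp_equiv (q : ℝ≥0∞) (a : ℤ → ℝ≥0∞) (e : ℤ ≃ ℤ) : lqN q (fun k => a (e k)) = lqN q a := by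
  by_cases hq : q = ∞
  · subst hq
    rw [lqN_top, lqN_top, e.iSup_comp]
  · rw [lqN_of_ne_top hq, lqN_of_ne_top hq, e.tsum_eq fun k => a k ^ q.toReal]

lemma exists_lqN_iSup_conv_le {ε : ℝ} {q : ℝ≥0∞} (hq0 : q ≠ 0) (hε : 0 ≤ ε)
    (hεq : q ≠ ∞ → 0 < ε) : ∃ C : NNReal, ∀ g : ℤ → ℝ≥0∞,
      lqN q (fun k => ⨆ j : ℤ, ENNReal.ofReal (2 ^ (-ε * |((k - j : ℤ) : ℝ)|)) * g j) ≤
        C * lqN q g := by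
  have hΓ := lqN_two_rpow_neg_abs_ne_top hq0 hε hεq
  set κ : ℤ → ℝ≥0∞ := fun n => ENNReal.ofReal (2 ^ (-ε * |(n : ℝ)|)) with hκ
  by_cases hq : q = ∞
  · subst hq
    refine ⟨1, fun g => ?_⟩
    rw [ENNReal.coe_one, one_mul, lqN_top, lqN_top]
    refine iSup_le fun k => iSup_mono fun j => mul_le_of_le_one_left' (ENNReal.ofReal_le_one.2 ?_)
    exact Real.rpow_le_one_of_one_le_of_nonpos one_le_two
      (mul_nonpos_of_nonpos_of_nonneg (by linarith) (abs_nonneg _))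
  · have hr : 0 < q.toReal := ENNReal.toReal_pos hq0 hq
    refine ⟨(lqN q κ).toNNReal, fun g => ?_⟩
    rw [ENNReal.coe_toNNReal hΓ]
    change lqN q (fun k => ⨆ j : ℤ, κ (k - j) * g j) ≤ _
    rw [lqN_of_ne_top hq, lqN_of_ne_top hq, lqN_of_ne_top hq,
      ← ENNReal.mul_rpow_of_nonneg _ _ (by positivity : 0 ≤ 1 / q.toReal)]
    gcongr
    calc ∑' k, (⨆ j : ℤ, κ (k - j) * g j) ^ q.toReal
        ≤ ∑' k, ∑' j : ℤ, (κ (k - j) * g j) ^ q.toReal := by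
          gcongr with k
          rw [← ENNReal.le_rpow_inv_iff hr, ← one_div, ← lqN_of_ne_top hq]
          exact iSup_le fun j => le_lqN hq0 (fun j => κ (k - j) * g j) j
      _ = ∑' j : ℤ, ∑' k, (κ (k - j) * g j) ^ q.toReal := ENNReal.tsum_comm
      _ = ∑' j : ℤ, (∑' k, κ k ^ q.toReal) * g j ^ q.toReal := by
          congr 1
          funext j
          simp only [ENNReal.mul_rpow_of_nonneg _ _ hr.le]
          rw [ENNReal.tsum_mul_right]
          congr 1
          exact (Equiv.subRight j).tsum_eq fun k => κ k ^ q.toReal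
      _ = _ := ENNReal.tsum_mul_left

/-- The modulus of continuity built from the values of a fractional gradient at a point. -/
def gradModulus (s β : ℝ) (D : NNReal) (g : ℤ → ℝ≥0∞) (t : ℝ) : ℝ≥0∞ :=
  D * ⨆ j : ℤ, min 1 (ENNReal.ofReal (t * 2 ^ (β * j))) * (ENNReal.ofReal (2 ^ (-s * j)) * g j)

lemma isRegularModulus_gradModulus {X : Type*} (s β : ℝ) (D : NNReal) (g : X → ℤ → ℝ≥0∞) :
    IsRegularModulus fun x => gradModulus s β D (g x) := by
  refine ⟨fun x t t' ht htt' => ?_, fun x k t hk ht => ?_⟩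
  · unfold gradModulus
    gcongr
  · unfold gradModulus
    rw [mul_left_comm]
    gcongr
    rw [ENNReal.mul_iSup]
    refine iSup_mono fun j => ?_
    rw [← mul_assoc (ENNReal.ofReal k)]
    refine mul_le_mul_left ?_ _
    rw [mul_assoc, ENNReal.ofReal_mul (by linarith)]
    have hk' : 1 ≤ ENNReal.ofReal k := ENNReal.one_le_ofReal.2 hk
    rcases min_choice 1 (ENNReal.ofReal (t * 2 ^ (β * j))) with h | h <;> rw [h]
    · exact (min_le_left _ _).trans (by rwa [mul_one])
    · exact min_le_right _ _

lemma exists_modulusCost_gradModulus_le {s β : ℝ} {q : ℝ≥0∞} (hs : 0 < s) (hq0 : q ≠ 0)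
    (hβ : s ≤ β) (hβq : q ≠ ∞ → s < β) (D : NNReal) : ∃ C : NNReal, ∀ g : ℤ → ℝ≥0∞,
      modulusCost s β q (gradModulus s β D g) ≤ C * lqN q g := by
  set ε := min s (β - s) with hε
  obtain ⟨C, hC⟩ := exists_lqN_iSup_conv_le (ε := ε) hq0 (le_min hs.le (by linarith))
    fun hq => lt_min hs (sub_pos.2 (hβq hq))
  refine ⟨D * C, fun g => ?_⟩
  rw [ENNReal.coe_mul, mul_assoc]
  refine le_trans ?_ (mul_le_mul_right (hC g) _)
  rw [← lqN_const_mul hq0]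
  refine lqN_mono q fun k => ?_
  unfold scaleWeight gradModulus
  split_ifs with hk
  swap
  · rw [zero_mul]
    exact zero_le
  rw [mul_left_comm]
  gcongr
  rw [ENNReal.mul_iSup]
  refine iSup_mono fun j => ?_
  rw [← mul_assoc, ← mul_assoc]
  gcongr
  set n : ℝ := ((k - j : ℤ) : ℝ) with hn
  have hkn : (k : ℝ) = n + j := by rw [hn]; push_cast; ring
  rcases le_total 0 n with h0 | h0
  · calc ENNReal.ofReal (2 ^ (s * k)) * min 1 (ENNReal.ofReal (2 ^ (-β * k) * 2 ^ (β * j))) *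
          ENNReal.ofReal (2 ^ (-s * j))
        ≤ ENNReal.ofReal (2 ^ (s * k)) * ENNReal.ofReal (2 ^ (-β * k) * 2 ^ (β * j)) *
          ENNReal.ofReal (2 ^ (-s * j)) := by
          gcongr
          exact min_le_right _ _
      _ = ENNReal.ofReal (2 ^ (-(β - s) * n)) := by
          rw [← ENNReal.ofReal_mul (by positivity), ← ENNReal.ofReal_mul (by positivity),
            ← Real.rpow_add two_pos, ← Real.rpow_add two_pos, ← Real.rpow_add two_pos, hkn]
          ring_nf
      _ ≤ _ := by
          rw [abs_of_nonneg h0]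
          gcongr
          · exact one_le_two
          · exact min_le_right _ _
  · calc ENNReal.ofReal (2 ^ (s * k)) * min 1 (ENNReal.ofReal (2 ^ (-β * k) * 2 ^ (β * j))) *
          ENNReal.ofReal (2 ^ (-s * j))
        ≤ ENNReal.ofReal (2 ^ (s * k)) * 1 * ENNReal.ofReal (2 ^ (-s * j)) := by
          gcongr
          exact min_le_left _ _
      _ = ENNReal.ofReal (2 ^ (-s * -n)) := by
          rw [mul_one, ← ENNReal.ofReal_mul (by positivity), ← Real.rpow_add two_pos, hkn]
          ring_nf
      _ ≤ _ := by
          rw [abs_of_nonpos h0]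
          gcongr
          · exact one_le_two
          · linarith
          · exact min_le_left _ _

section

variable {X : Type*} [PseudoMetricSpace X] [MeasurableSpace X] {ρ : X → X → ℝ} {β c : ℝ}

lemma hasModulus_gradModulus (hρ : IsQuasiDist ρ) (hβ : 0 < β) (hc : 1 ≤ c)
    (hd : ∀ x y, dist x y ≤ c * ρ x y ^ β ∧ ρ x y ^ β ≤ c * dist x y) {s : ℝ} (hs : 0 < s)
    {D : NNReal} (hD : c * 2 ^ β ≤ D) {S : Set X} {u : X → ℝ} {g : ℤ → X → ℝ} (hu : Measurable u)
    (hg : ∀ k, Measurable (g k))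
    (h : ∀ k : ℤ, ∀ x ∈ S, ∀ y ∈ S, (2 : ℝ) ^ (-k - 1) ≤ ρ x y → ρ x y < (2 : ℝ) ^ (-k) →
      |u x - u y| ≤ ρ x y ^ s * (g k x + g k y)) :
    HasModulus S u fun x => gradModulus s β D fun k => ENNReal.ofReal (g k x) := by
  have hc0 : 0 < c := by linarith
  refine ⟨hu, fun t => ?_, fun x hx y hy t ht hxy => ?_⟩
  · unfold gradModulus
    exact (Measurable.iSup fun j => ((hg j).ennreal_ofReal.const_mul _).const_mul _).const_mul _
  rcases (hρ.1 x y).eq_or_lt with h0 | h0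
  · rw [(hρ.2.1 x y).1 h0.symm, edist_self]
    exact zero_le
  obtain ⟨n, hn1, hn2⟩ := exists_mem_Ico_zpow h0 one_lt_two
  obtain ⟨k, rfl⟩ : ∃ k : ℤ, n = -k - 1 := ⟨-n - 1, by ring⟩
  rw [sub_add_cancel] at hn2
  have h1 := h k x hx y hy hn1 hn2
  have h2 : ρ x y ^ s ≤ 2 ^ (-s * k) := by
    calc ρ x y ^ s ≤ ((2 : ℝ) ^ (-k)) ^ s := by gcongr
      _ = _ := by
        rw [← Real.rpow_intCast, ← Real.rpow_mul zero_le_two]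
        push_cast
        ring_nf
  have h3 : (1 : ℝ) ≤ D * (t * 2 ^ (β * k)) := by
    have h4 : (2 : ℝ) ^ (β * (-k - 1)) ≤ c * t := by
      calc (2 : ℝ) ^ (β * (-k - 1)) = ((2 : ℝ) ^ (-k - 1)) ^ β := by
            rw [← Real.rpow_intCast, ← Real.rpow_mul zero_le_two]
            push_cast
            ring_nf
        _ ≤ ρ x y ^ β := by gcongr
        _ ≤ c * dist x y := (hd x y).2
        _ ≤ c * t := by gcongr
    calc (1 : ℝ) = 2 ^ (β * (-k - 1)) * (2 ^ β * 2 ^ (β * k)) := by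
          rw [← Real.rpow_add two_pos, ← Real.rpow_add two_pos]
          ring_nf
          simp
      _ ≤ c * t * (2 ^ β * 2 ^ (β * k)) := by gcongr
      _ = c * 2 ^ β * (t * 2 ^ (β * k)) := by ring
      _ ≤ _ := by gcongr
  have hD1 : (1 : ℝ) ≤ D :=
    (one_le_mul_of_one_le_of_one_le hc (Real.one_le_rpow one_le_two hβ.le)).trans hD
  have h5 : 1 ≤ (D : ℝ≥0∞) * min 1 (ENNReal.ofReal (t * 2 ^ (β * k))) := by
    rw [← ENNReal.ofReal_coe_nnreal, ← ENNReal.ofReal_one, ← ENNReal.ofReal_min,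
      ← ENNReal.ofReal_mul D.coe_nonneg]
    refine ENNReal.ofReal_le_ofReal ?_
    rw [mul_min_of_nonneg _ _ D.coe_nonneg, mul_one]
    exact le_min hD1 h3
  have h6 : ∀ z, ENNReal.ofReal (2 ^ (-s * k)) * ENNReal.ofReal (g k z) ≤
      gradModulus s β D (fun k => ENNReal.ofReal (g k z)) t := fun z => by
    unfold gradModulus
    refine (le_mul_of_one_le_left' h5).trans ?_
    rw [mul_assoc]
    gcongr
    exact le_iSup (fun j : ℤ => min 1 (ENNReal.ofReal (t * 2 ^ (β * j))) *
      (ENNReal.ofReal (2 ^ (-s * j)) * ENNReal.ofReal (g j z))) k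
  refine le_trans ?_ (add_le_add (h6 x) (h6 y))
  rw [edist_dist, Real.dist_eq, ← mul_add]
  refine (ENNReal.ofReal_le_ofReal h1).trans ?_
  rw [ENNReal.ofReal_mul (by positivity)]
  gcongr
  exact ENNReal.ofReal_add_le

end

section

variable {X : Type*} [MeasurableSpace X] {ρ : X → X → ℝ} {μ : Measure X}

lemma lpN_ne_top {p : ℝ} (hp : 0 < p) {f : X → ℝ≥0∞} :
    lpN μ p f ≠ ∞ ↔ ∫⁻ x, f x ^ p ∂μ ≠ ∞ := by
  unfold lpN
  rw [Ne, ENNReal.rpow_eq_top_iff_of_pos (by positivity)]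

lemma mdotNorm_ne_top_iff {Ω : Set X} {s p : ℝ} (hp : 0 < p) {q : ℝ≥0∞} {u : X → ℝ} :
    MdotNorm ρ μ Ω s p q u ≠ ∞ ↔ ∃ g ∈ fracGrad ρ μ Ω s u,
      ∫⁻ x in Ω, lqN q (fun k => ENNReal.ofReal (g k x)) ^ p ∂μ ≠ ∞ := by
  unfold MdotNorm
  simp only [← lpN_ne_top hp, ← lt_top_iff_ne_top, iInf_lt_iff, exists_prop]

lemma lpOn_ne_top_iff {Ω : Set X} {p : ℝ} (hp : 0 < p) {u : X → ℝ} :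
    lpOn μ Ω p u ≠ ∞ ↔ ∫⁻ x in Ω, ‖u x‖ₑ ^ p ∂μ ≠ ∞ := by
  unfold lpOn
  rw [lpN_ne_top hp]
  simp only [← Real.norm_eq_abs, ofReal_norm]

lemma MemMspq.restrict {s p : ℝ} (hp : 0 < p) {q : ℝ≥0∞} {Ω : Set X} {u v : X → ℝ}
    (hu : AEMeasurable u (μ.restrict Ω)) (hΩ : MeasurableSet Ω) (hv : MemMspq ρ μ univ s p q v)
    (huv : ∀ᵐ x ∂μ.restrict Ω, v x = u x) : MemMspq ρ μ Ω s p q u := by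
  obtain ⟨-, hv1, hv2⟩ := hv
  rw [lpOn_ne_top_iff hp, Measure.restrict_univ] at hv1
  obtain ⟨g, ⟨hg0, hgm, E, hE, hg⟩, hgf⟩ := (mdotNorm_ne_top_iff hp).1 hv2
  rw [Measure.restrict_univ] at hgf
  simp only [Measure.restrict_univ] at hgm
  refine ⟨hu, (lpOn_ne_top_iff hp).2 ?_, (mdotNorm_ne_top_iff hp).2 ⟨g, ⟨hg0,
    fun k => (hgm k).restrict, E ∪ {x | x ∈ Ω ∧ v x ≠ u x}, ?_, ?_⟩,
    ne_top_of_le_ne_top hgf (setLIntegral_le_lintegral _ _)⟩⟩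
  · rw [lintegral_congr_ae (g := fun x => ‖v x‖ₑ ^ p) (huv.mono fun x hx => by simp only [hx])]
    exact ne_top_of_le_ne_top hv1 (setLIntegral_le_lintegral _ _)
  · refine measure_union_null hE ?_
    rw [ae_restrict_iff' hΩ, ae_iff] at huv
    simpa using huv
  · rintro k x ⟨hx, hxE⟩ y ⟨hy, hyE⟩ h1 h2
    simp only [mem_union, mem_ofPred_eq, not_or, not_and, not_not] at hxE hyE
    rw [← hxE.2 hx, ← hyE.2 hy]
    exact hg k x ⟨mem_univ _, hxE.1⟩ y ⟨mem_univ _, hyE.1⟩ h1 h2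

end

section

variable {X : Type*} [PseudoMetricSpace X] [MeasurableSpace X] {ρ : X → X → ℝ} {β c : ℝ}
  {μ : Measure X}

lemma HasModulus.memMspq (hρ : IsQuasiDist ρ) (hβ : 0 < β) (hc : 1 ≤ c)
    (hd : ∀ x y, dist x y ≤ c * ρ x y ^ β ∧ ρ x y ^ β ≤ c * dist x y) {s p : ℝ} (hs : 0 < s)
    (hp : 0 < p) {q : ℝ≥0∞} (hq0 : q ≠ 0) {T : Set X} (hT : μ Tᶜ = 0) {v : X → ℝ}
    {W : X → ℝ → ℝ≥0∞} (hv : HasModulus T v W)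
    (hfin : ∫⁻ x, energy (modulusCost s β q) p v W x ∂μ ≠ ∞) : MemMspq ρ μ univ s p q v := by
  have hc0 : 0 < c := by linarith
  obtain ⟨K, hK⟩ := exists_lqN_add_le hq0
  obtain ⟨n, hn⟩ := pow_unbounded_of_one_lt c (Real.one_lt_rpow one_lt_two hβ)
  rw [← Real.rpow_natCast, ← Real.rpow_mul zero_le_two] at hn
  set L : ℤ := (n : ℤ) with hL
  have hLn : (L : ℝ) = n := by rw [hL, Int.cast_natCast]
  set A : ℝ≥0∞ := ENNReal.ofReal (2 ^ (s * (L + 1))) with hA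
  set B : ℝ≥0∞ := ENNReal.ofReal (2 ^ (s * L)) with hB
  set Γ : ℝ≥0∞ := lqN q fun k => ENNReal.ofReal (2 ^ (-s * |(k : ℝ)|)) with hΓ
  have hΓt : Γ ≠ ∞ := lqN_two_rpow_neg_abs_ne_top hq0 hs.le fun _ => hs
  set H : ℤ → X → ℝ≥0∞ := fun k x =>
    A * (scaleWeight s (k - L) * W x (2 ^ (-β * ((k - L : ℤ) : ℝ)))) +
      B * (‖v x‖ₑ * ENNReal.ofReal (2 ^ (-s * |((k + 1 - L : ℤ) : ℝ)|))) with hH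
  have hHm : ∀ k, Measurable (H k) := fun k =>
    (((hv.2 _).const_mul _).const_mul _).add ((hv.1.enorm.mul_const _).const_mul _)
  have hkey : ∀ k : ℤ, ∀ x ∈ T, ∀ y ∈ T, (2 : ℝ) ^ (-k - 1) ≤ ρ x y → ρ x y < (2 : ℝ) ^ (-k) →
      edist (v x) (v y) ≤ ENNReal.ofReal (2 ^ (-s * (k + 1))) * (H k x + H k y) := by
    intro k x hx y hy h1 h2
    rw [mul_add]
    rcases le_or_gt L k with hk | hk
    · have hw : ∀ z, W z (2 ^ (-β * ((k - L : ℤ) : ℝ))) ≤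
          ENNReal.ofReal (2 ^ (-s * (k + 1))) * H k z := by
        intro z
        calc W z (2 ^ (-β * ((k - L : ℤ) : ℝ)))
            = ENNReal.ofReal (2 ^ (-s * (k + 1))) *
                (A * (scaleWeight s (k - L) * W z (2 ^ (-β * ((k - L : ℤ) : ℝ))))) := by
              rw [scaleWeight, if_pos (sub_nonneg.2 hk), ← mul_assoc, ← mul_assoc, hA,
                ← ENNReal.ofReal_mul (by positivity), ← ENNReal.ofReal_mul (by positivity),
                ← Real.rpow_add two_pos, ← Real.rpow_add two_pos]
              push_cast
              ring_nf
              simp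
          _ ≤ _ := by
              gcongr
              exact le_self_add
      refine (hv.edist_le x hx y hy _ (by positivity) ?_).trans (add_le_add (hw x) (hw y))
      calc dist x y ≤ c * ρ x y ^ β := (hd x y).1
        _ ≤ c * ((2 : ℝ) ^ (-k)) ^ β := by
            gcongr
            exact hρ.1 x y
        _ < 2 ^ (β * n) * ((2 : ℝ) ^ (-k)) ^ β := by gcongr
        _ = _ := by
            rw [← Real.rpow_intCast, ← Real.rpow_mul zero_le_two, ← Real.rpow_add two_pos]
            push_cast
            rw [hLn]
            ring_nf
    · have hw : ∀ z, ‖v z‖ₑ ≤ ENNReal.ofReal (2 ^ (-s * (k + 1))) * H k z := by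
        intro z
        have habs : |((k + 1 - L : ℤ) : ℝ)| = -((k + 1 - L : ℤ) : ℝ) :=
          abs_of_nonpos (by exact_mod_cast (by omega : k + 1 - L ≤ 0))
        calc ‖v z‖ₑ = ENNReal.ofReal (2 ^ (-s * (k + 1))) *
              (B * (‖v z‖ₑ * ENNReal.ofReal (2 ^ (-s * |((k + 1 - L : ℤ) : ℝ)|)))) := by
              rw [mul_comm ‖v z‖ₑ, ← mul_assoc, ← mul_assoc, hB, habs,
                ← ENNReal.ofReal_mul (by positivity), ← ENNReal.ofReal_mul (by positivity),
                ← Real.rpow_add two_pos, ← Real.rpow_add two_pos]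
              push_cast
              ring_nf
              simp
          _ ≤ _ := by
              gcongr
              exact le_add_self
      refine le_trans ?_ (add_le_add (hw x) (hw y))
      rw [← edist_zero_right, ← edist_zero_right, edist_comm (v y)]
      exact edist_triangle _ _ _
  set M : ℝ≥0∞ := K * (A + B * Γ) with hM
  have hMt : M ≠ ∞ := ENNReal.mul_ne_top ENNReal.coe_ne_top (ENNReal.add_ne_top.2
    ⟨ENNReal.ofReal_ne_top, ENNReal.mul_ne_top ENNReal.ofReal_ne_top hΓt⟩)
  set M' : ℝ≥0∞ := M ^ p * 2 ^ p with hM'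
  have hMt' : M' ≠ ∞ := ENNReal.mul_ne_top (ENNReal.rpow_ne_top_of_nonneg hp.le hMt)
    (ENNReal.rpow_ne_top_of_nonneg hp.le ofNat_ne_top)
  have hlq : ∀ x, lqN q (fun k => H k x) ^ p ≤ M' * energy (modulusCost s β q) p v W x := by
    intro x
    have h1 : lqN q (fun k => H k x) ≤ M * (modulusCost s β q (W x) + ‖v x‖ₑ) := by
      refine (hK _ _).trans ?_
      rw [hM, mul_assoc]
      gcongr
      rw [lqN_const_mul hq0, lqN_const_mul hq0, lqN_const_mul hq0]
      have h2 : lqN q (fun k => ENNReal.ofReal (2 ^ (-s * |((k + 1 - L : ℤ) : ℝ)|))) = Γ :=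
        lqN_comp_equiv q (fun k => ENNReal.ofReal (2 ^ (-s * |(k : ℝ)|)))
          ((Equiv.addRight 1).trans (Equiv.subRight L))
      have h3 : lqN q (fun k => scaleWeight s (k - L) * W x (2 ^ (-β * ((k - L : ℤ) : ℝ)))) =
          modulusCost s β q (W x) :=
        lqN_comp_equiv q (fun k => scaleWeight s k * W x (2 ^ (-β * k))) (Equiv.subRight L)
      rw [h2, h3, add_mul, mul_add, mul_add, mul_comm ‖v x‖ₑ, ← mul_assoc B]
      exact add_le_add le_self_add le_add_self
    refine (ENNReal.rpow_le_rpow h1 hp.le).trans ?_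
    rw [ENNReal.mul_rpow_of_nonneg _ _ hp.le, hM', mul_assoc]
    gcongr
    exact add_rpow_le_two_rpow_mul _ _ hp
  have hen : ∀ x, energy (modulusCost s β q) p v W x ≠ ∞ → ∀ k, H k x ≠ ∞ := by
    intro x hx k
    refine ne_top_of_le_ne_top ?_ (le_lqN hq0 (fun k => H k x) k)
    have := ne_top_of_le_ne_top (ENNReal.mul_ne_top hMt' hx) (hlq x)
    rwa [Ne, ENNReal.rpow_eq_top_iff_of_pos hp] at this
  have hNm : Measurable (modulusCost s β q) := (measurable_lqN q).comp
    (measurable_pi_lambda _ fun k => (measurable_pi_apply _).const_mul _)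
  refine ⟨hv.1.aemeasurable, (lpOn_ne_top_iff hp).2 ?_, (mdotNorm_ne_top_iff hp).2
    ⟨fun k x => (H k x).toReal, ⟨fun _ _ => ENNReal.toReal_nonneg,
      fun k => (hHm k).ennreal_toReal.aemeasurable,
      Tᶜ ∪ {x | ¬ energy (modulusCost s β q) p v W x < ∞}, ?_, ?_⟩, ?_⟩⟩
  · rw [Measure.restrict_univ]
    exact ne_top_of_le_ne_top hfin (lintegral_mono fun x => le_add_self)
  · exact measure_union_null hT (ae_lt_top (measurable_energy hNm hv.1 hv.2) hfin)
  · rintro k x ⟨-, hx⟩ y ⟨-, hy⟩ h1 h2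
    simp only [mem_union, mem_compl_iff, mem_ofPred_eq, not_or, not_not] at hx hy
    have h3 := hkey k x hx.1 y hy.1 h1 h2
    have hxk := hen x hx.2.ne k
    have hyk := hen y hy.2.ne k
    rw [← ENNReal.ofReal_toReal hxk, ← ENNReal.ofReal_toReal hyk,
      ← ENNReal.ofReal_add toReal_nonneg toReal_nonneg, ← ENNReal.ofReal_mul (by positivity),
      edist_dist, ENNReal.ofReal_le_ofReal_iff (by positivity), Real.dist_eq] at h3
    refine h3.trans ?_
    gcongr
    calc (2 : ℝ) ^ (-s * (k + 1)) = ((2 : ℝ) ^ (-k - 1)) ^ s := by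
          rw [← Real.rpow_intCast, ← Real.rpow_mul zero_le_two]
          push_cast
          ring_nf
      _ ≤ ρ x y ^ s := by gcongr
  · rw [Measure.restrict_univ]
    refine ne_top_of_le_ne_top (ENNReal.mul_ne_top hMt' hfin) ?_
    rw [← lintegral_const_mul' _ _ hMt']
    refine lintegral_mono fun x => le_trans ?_ (hlq x)
    gcongr
    exact lqN_mono q fun k => ENNReal.ofReal_toReal_le

end

lemma MemMspq.exists_extension
    {X : Type*} [MeasurableSpace X] {ρ : X → X → ℝ} {μ : Measure X}
    (hX : IsQMMS ρ μ) {Q : ℝ} (hdoub : QDoubling ρ μ Q)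
    {s p : ℝ} {q : ℝ≥0∞} (hs : 0 < s) (hp : 0 < p) (hq : 0 < q)
    (hind : SPrecIndex ρ s q)
    {Ω : Set X} (hΩ : MeasurableSet Ω) (hΩne : Ω.Nonempty)
    (hdens : MeasDensity ρ μ Ω) {u : X → ℝ} (hu : MemMspq ρ μ Ω s p q u) :
    ∃ v : X → ℝ, MemMspq ρ μ univ s p q v ∧ ∀ᵐ x ∂μ.restrict Ω, v x = u x := by
  obtain ⟨β, m, c, hsβ, hsβq, hc, hd⟩ := exists_metric hX.quasi hs hind
  have hβ : 0 < β := hs.trans_le hsβ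
  have := hX.sigmaFinite
  have := hX.secondCountableTopology hβ hc hd
  have := hX.opensMeasurableSpace hβ hc hd
  obtain ⟨hum, hup, huq⟩ := hu
  rw [lpOn_ne_top_iff hp] at hup
  obtain ⟨g, ⟨-, hgm, E, hE, hg⟩, hgf⟩ := (mdotNorm_ne_top_iff hp).1 huq
  have hae : ∀ᵐ x ∂μ.restrict Ω, hum.mk u x = u x ∧ ∀ k, (hgm k).mk (g k) x = g k x :=
    (hum.ae_eq_mk.mono fun _ h => h.symm).and
      (ae_all_iff.2 fun k => (hgm k).ae_eq_mk.mono fun _ h => h.symm)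
  have hae' := hae
  rw [ae_restrict_iff' hΩ, ae_iff] at hae'
  set Z := toMeasurable μ (E ∪ {x | ¬(x ∈ Ω → hum.mk u x = u x ∧
    ∀ k, (hgm k).mk (g k) x = g k x)}) with hZdef
  have hZ : MeasurableSet Z := measurableSet_toMeasurable _ _
  have hZ0 : μ Z = 0 := by
    rw [hZdef, measure_toMeasurable]
    exact measure_union_null hE hae'
  have hsub := subset_toMeasurable μ (E ∪ {x | ¬(x ∈ Ω → hum.mk u x = u x ∧
    ∀ k, (hgm k).mk (g k) x = g k x)})
  have hΩZ : ∀ x ∈ Ω \ Z, x ∉ E ∧ hum.mk u x = u x ∧ ∀ k, (hgm k).mk (g k) x = g k x := by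
    intro x hx
    have : ¬ _ := fun h => hx.2 (hsub h)
    simp only [mem_union, mem_ofPred_eq, not_or, not_not] at this
    exact ⟨this.1, this.2 hx.1⟩
  have hD := (hX.doublingDomain hdoub hβ hc hd hΩ hdens).sdiff_null hZ hZ0
  have hne : (Ω \ Z).Nonempty := by
    obtain ⟨x, hx⟩ := hΩne
    obtain ⟨b, -, hb⟩ := hdens
    have h1 := hb x hx 1 one_pos le_rfl
    have h2 : μ (Ω \ Z) ≠ 0 := by
      rw [measure_sdiff_null hZ0]
      intro h0
      rw [measure_mono_null inter_subset_right h0, mul_zero] at h1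
      exact (hX.ball_pos x 1 one_pos).not_ge h1
    exact nonempty_of_measure_ne_zero h2
  have hq0 : q ≠ 0 := hq.ne'
  obtain ⟨K, hN⟩ := exists_isCost_modulusCost hs hq0 hsβ hsβq
  have hD0 : c * 2 ^ β ≤ ((c * 2 ^ β).toNNReal : ℝ) := Real.le_coe_toNNReal _
  have hmod := hasModulus_gradModulus (S := Ω \ Z) hX.quasi hβ hc hd hs hD0
    hum.measurable_mk (fun k => (hgm k).measurable_mk) fun k x hx y hy h1 h2 => by
      obtain ⟨hxE, hxu, hxg⟩ := hΩZ x hx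
      obtain ⟨hyE, hyu, hyg⟩ := hΩZ y hy
      rw [hxu, hyu, hxg, hyg]
      exact hg k x ⟨hx.1, hxE⟩ y ⟨hy.1, hyE⟩ h1 h2
  obtain ⟨C, hC⟩ := exists_modulusCost_gradModulus_le hs hq0 hsβ hsβq (c * 2 ^ β).toNNReal
  have hCp : (C : ℝ≥0∞) ^ p ≠ ∞ := ENNReal.rpow_ne_top_of_nonneg hp.le ENNReal.coe_ne_top
  have hfin : ∫⁻ x in Ω \ Z, energy (modulusCost s β q) p (hum.mk u) (fun x =>
      gradModulus s β (c * 2 ^ β).toNNReal fun k => ENNReal.ofReal ((hgm k).mk (g k) x)) x ∂μ ≠ ∞ := by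
    have hle : ∀ x ∈ Ω \ Z, energy (modulusCost s β q) p (hum.mk u) (fun x =>
        gradModulus s β (c * 2 ^ β).toNNReal fun k => ENNReal.ofReal ((hgm k).mk (g k) x)) x ≤
        (C : ℝ≥0∞) ^ p * lqN q (fun k => ENNReal.ofReal ((hgm k).mk (g k) x)) ^ p +
          ‖hum.mk u x‖ₑ ^ p := by
      intro x _
      unfold energy
      rw [← ENNReal.mul_rpow_of_nonneg _ _ hp.le]
      gcongr
      exact hC _
    refine ne_top_of_le_ne_top ?_ (setLIntegral_mono' hD.measurableSet hle)
    refine ne_top_of_le_ne_top ?_ (lintegral_mono_set sdiff_subset)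
    rw [lintegral_add_right _ (hum.measurable_mk.enorm.pow_const p), lintegral_const_mul' _ _ hCp]
    refine ENNReal.add_ne_top.2 ⟨ENNReal.mul_ne_top hCp ?_, ?_⟩
    · rwa [lintegral_congr_ae (g := fun x => lqN q (fun k => ENNReal.ofReal (g k x)) ^ p)
        (hae.mono fun x hx => by simp only [hx.2])]
    · rwa [lintegral_congr_ae (g := fun x => ‖u x‖ₑ ^ p) (hae.mono fun x hx => by simp only [hx.1])]
  obtain ⟨T, v, W, hT, hv, hvu, hvfin⟩ := hmod.exists_extension hD hne hN hp
    (isRegularModulus_gradModulus _ _ _ _) hfin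
  refine ⟨v, hv.memMspq hX.quasi hβ hc hd hs hp hq0 hT hvfin, ?_⟩
  rw [ae_restrict_iff' hΩ]
  filter_upwards [measure_eq_zero_iff_ae_notMem.1 hZ0] with x hxZ hxΩ
  rw [hvu x ⟨hxΩ, hxZ⟩, (hΩZ x ⟨hxΩ, hxZ⟩).2.1]

end

/-- Theorem 1.1 (trace part): under the measure density condition,
`M^s_{p,q}(Ω)` is exactly the set of restrictions to `Ω` of members of `M^s_{p,q}(X)`. -/
theorem M_space_eq_restrictions
    {X : Type*} [MeasurableSpace X] (ρ : X → X → ℝ) (μ : Measure X)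
    (hX : IsQMMS ρ μ) (hreg : BorelRegular μ)
    (Q : ℝ) (hQ : 0 < Q) (hdoub : QDoubling ρ μ Q)
    (s p : ℝ) (q : ℝ≥0∞) (hs : 0 < s) (hp : 0 < p) (hq : 0 < q)
    (hind : SPrecIndex ρ s q)
    (Ω : Set X) (hΩmeas : MeasurableSet Ω) (hΩne : Ω.Nonempty)
    (hdens : MeasDensity ρ μ Ω) :
    ∀ u : X → ℝ, AEMeasurable u (μ.restrict Ω) →
      (MemMspq ρ μ Ω s p q u ↔
        ∃ v : X → ℝ, MemMspq ρ μ Set.univ s p q v ∧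
          ∀ᵐ x ∂μ.restrict Ω, v x = u x) := by
  exact fun u hu => ⟨fun h => h.exists_extension hX hdoub hs hp hq hind hΩmeas hΩne hdens,
    fun ⟨v, hv, huv⟩ => hv.restrict hp hu hΩmeas huv⟩

end HajlaszPaper
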